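/- arXiv:2009.00423 — 2 statements merged into one kernel-verified Lean document; each statement's English description precedes it below -/
import Mathlib

section
/- Every 3-connected cubic planar graph of circumference at least 5 contains a cycle whose length ℓ satisfies 5 ≤ ℓ ≤ 12, i.e., Merker's conjecture holds for k = 5. -/
open SimpleGraph

/-- The cycle spectrum of a graph: the set of lengths of its cycles. -/
def CycleLengths {V : Type*} (G : SimpleGraph V) : Set ℕ :=
  {n | ∃ (v : V) (w : G.Walk v v), w.IsCycle ∧ w.length = n}

/-- `G` has circumference at least `k`: some cycle has length at least `k`. -/
def CircumferenceAtLeast {V : Type*} (G : SimpleGraph V) (k : ℕ) : Prop :=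
  ∃ n ∈ CycleLengths G, k ≤ n

/-- A graph is cubic if every vertex has exactly three neighbours. -/
def IsCubic {V : Type*} (G : SimpleGraph V) : Prop :=
  ∀ v : V, (G.neighborSet v).ncard = 3

/-- A graph is 3-connected if it has more than 3 vertices and deleting any set of
fewer than 3 vertices leaves it connected. -/
def IsThreeConnected {V : Type*} (G : SimpleGraph V) : Prop :=
  3 < (Set.univ : Set V).ncard ∧
    ∀ s : Set V, s.Finite → s.ncard < 3 → (G.induce (sᶜ : Set V)).Connected

/-- Reversal of darts, as a permutation. -/
def dartReversal {V : Type*} (G : SimpleGraph V) : Equiv.Perm G.Dart :=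
  Function.Involutive.toPerm SimpleGraph.Dart.symm Dart.symm_involutive

/-- A combinatorial embedding of `G` on an orientable surface, given by a rotation
system: a permutation of the darts preserving tails, acting transitively on the
darts at each vertex. -/
structure PlaneEmbedding {V : Type*} (G : SimpleGraph V) where
  rot : Equiv.Perm G.Dart
  rot_tail : ∀ d : G.Dart, (rot d).toProd.1 = d.toProd.1
  rot_orbit : ∀ d e : G.Dart, d.toProd.1 = e.toProd.1 → ∃ n : ℕ, (rot ^ n) d = e

namespace PlaneEmbedding

variable {V : Type*} {G : SimpleGraph V}

/-- The face permutation of a combinatorial embedding. -/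
def facePerm (E : PlaneEmbedding G) : Equiv.Perm G.Dart :=
  (dartReversal G).trans E.rot

/-- The face (orbit of the face permutation) containing a given dart. -/
def faceOf (E : PlaneEmbedding G) (d : G.Dart) : Set G.Dart :=
  {e | ∃ n : ℤ, (E.facePerm ^ n) d = e}

/-- The set of faces of a combinatorial embedding. -/
def faces (E : PlaneEmbedding G) : Set (Set G.Dart) :=
  {s | ∃ d : G.Dart, s = E.faceOf d}

/-- A combinatorial embedding is spherical (planar) when Euler's formula
`|V| + |F| = |E| + 2` holds. -/
def IsSpherical (E : PlaneEmbedding G) : Prop :=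
  (Set.univ : Set V).ncard + E.faces.ncard = G.edgeSet.ncard + 2

end PlaneEmbedding

/-- A graph is planar if it is connected and admits a spherical combinatorial
embedding (Heffter–Edmonds). -/
def IsPlanar {V : Type*} (G : SimpleGraph V) : Prop :=
  G.Connected ∧ ∃ E : PlaneEmbedding G, E.IsSpherical

namespace SimpleGraph

variable {V : Type*} {G : SimpleGraph V}

lemma Preconnected.induction_of_adj (h : G.Preconnected) {P : V → Prop}
    (step : ∀ u v, G.Adj u v → P u → P v) {a : V} (ha : P a) (v : V) : P v := by
  obtain ⟨w⟩ := h a v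
  induction w with
  | nil => exact ha
  | cons hadj _ ih => exact ih (step _ _ hadj ha)

lemma add_three_mem_cycleLengths {n : ℕ} (f : Fin (n + 3) → V) (hf : Function.Injective f)
    (hadj : ∀ i, G.Adj (f i) (f (i + 1))) : n + 3 ∈ CycleLengths G := by
  refine (cycleGraph_isContained_iff (by lia)).1 ⟨⟨⟨f, ?_⟩, hf⟩⟩
  intro u v huv
  rw [cycleGraph_adj] at huv
  rcases huv with h | h
  · rw [sub_eq_iff_eq_add'.1 h]
    exact add_comm v 1 ▸ (add_comm v 1 ▸ hadj v).symm
  · rw [sub_eq_iff_eq_add'.1 h]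
    exact add_comm u 1 ▸ hadj u

lemma five_mem_cycleLengths {a b c d e : V} (hn : [a, b, c, d, e].Nodup) (h1 : G.Adj a b)
    (h2 : G.Adj b c) (h3 : G.Adj c d) (h4 : G.Adj d e) (h5 : G.Adj e a) : 5 ∈ CycleLengths G := by
  refine add_three_mem_cycleLengths (n := 2) [a, b, c, d, e].get hn.injective_get ?_
  intro i
  fin_cases i <;> assumption

lemma six_mem_cycleLengths {a b c d e f : V} (hn : [a, b, c, d, e, f].Nodup) (h1 : G.Adj a b)
    (h2 : G.Adj b c) (h3 : G.Adj c d) (h4 : G.Adj d e) (h5 : G.Adj e f) (h6 : G.Adj f a) :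
    6 ∈ CycleLengths G := by
  refine add_three_mem_cycleLengths (n := 3) [a, b, c, d, e, f].get hn.injective_get ?_
  intro i
  fin_cases i <;> assumption

lemma eq_of_adj_of_isCubic (hc : IsCubic G) {v p q r s : V} (hp : G.Adj v p) (hq : G.Adj v q)
    (hr : G.Adj v r) (hs : G.Adj v s) (hpq : p ≠ q) (hpr : p ≠ r) (hqr : q ≠ r) :
    s = p ∨ s = q ∨ s = r := by
  have hsub : ({p, q, r} : Set V) ⊆ G.neighborSet v := by
    rintro x (rfl | rfl | rfl) <;> assumption
  have hcard : ({p, q, r} : Set V).ncard = 3 := Set.ncard_eq_three.2 ⟨p, q, r, hpq, hpr, hqr, rfl⟩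
  have := Set.eq_of_subset_of_ncard_le hsub (by rw [hc, hcard])
    (Set.finite_of_ncard_pos (by rw [hc]; lia))
  have hs' : s ∈ ({p, q, r} : Set V) := this ▸ hs
  simpa using hs'

lemma exists_adj_ne_of_isCubic (hc : IsCubic G) (u v : V) : ∃ w, G.Adj u w ∧ w ≠ v :=
  Set.exists_ne_of_one_lt_ncard (s := G.neighborSet u) (by rw [hc]; lia) v

lemma le_card_of_circumferenceAtLeast [Fintype V] {k : ℕ} (h : CircumferenceAtLeast G k) :
    k ≤ Fintype.card V := by
  obtain ⟨n, ⟨v, w, hw, rfl⟩, hk⟩ := h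
  have := hw.support_nodup.length_le_card
  simp at this
  lia

/-- In a 3-connected cubic graph on more than four vertices no two triangles share an edge. -/
lemma false_of_triangles_share_edge [Fintype V] (h3 : IsThreeConnected G) (hc : IsCubic G)
    (hcard : 5 ≤ Fintype.card V) {a b x y : V} (hab : G.Adj a b) (hax : G.Adj a x)
    (hbx : G.Adj b x) (hay : G.Adj a y) (hby : G.Adj b y) (hxy : x ≠ y) : False := by
  classical
  have hconn := (h3.2 {x, y} (Set.toFinite _)
    ((Set.ncard_insert_le _ _).trans_lt (by simp))).preconnected
  have key : ∀ v : (({x, y} : Set V)ᶜ : Set V), v.1 = a ∨ v.1 = b := by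
    refine hconn.induction_of_adj (a := ⟨a, by simp [hax.ne, hay.ne]⟩) ?_ (Or.inl rfl)
    rintro ⟨u, hu⟩ ⟨v, hv⟩ huv (rfl | rfl) <;> simp at hv huv
    · have := eq_of_adj_of_isCubic hc hab hax hay huv hbx.ne hby.ne hxy
      tauto
    · have := eq_of_adj_of_isCubic hc hab.symm hbx hby huv hax.ne hay.ne hxy
      tauto
  have huniv : (Finset.univ : Finset V) ⊆ {a, b, x, y} := by
    intro v _
    by_cases hv : v = x ∨ v = y
    · simp; tauto
    · have := key ⟨v, by simpa using hv⟩
      simp at this ⊢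
      tauto
  have := (Finset.card_le_card huniv).trans Finset.card_le_four
  rw [Finset.card_univ] at this
  lia

/-- The removal of an edge does not disconnect a 3-connected cubic graph. -/
lemma eq_of_forall_adj_ne_edge [Finite V] {α : Type*} (h3 : IsThreeConnected G) (hc : IsCubic G)
    (e : Sym2 V) (ψ : V → α) (hψ : ∀ u v, G.Adj u v → s(u, v) ≠ e → ψ u = ψ v) (x y : V) :
    ψ x = ψ y := by
  induction e with | _ a b
  obtain ⟨w, haw, hwb⟩ := exists_adj_ne_of_isCubic hc a b
  have hconn := (h3.2 {a} (Set.toFinite _) (by simp)).preconnected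
  have hw : ∀ v : (({a} : Set V)ᶜ : Set V), ψ v = ψ w := by
    refine hconn.induction_of_adj (a := ⟨w, by simpa using haw.ne'⟩) ?_ rfl
    rintro ⟨u, hu⟩ ⟨v, hv⟩ huv h
    refine (hψ u v huv ?_).symm.trans h
    simp at hu hv ⊢
    tauto
  have hall : ∀ v, ψ v = ψ w := by
    intro v
    by_cases hv : v = a
    · subst hv
      refine hψ v w haw ?_
      simp
      grind
    · exact hw ⟨v, hv⟩
  rw [hall x, hall y]

lemma ncard_setOf_dart_fst (hc : IsCubic G) (v : V) : {e : G.Dart | e.fst = v}.ncard = 3 := by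
  rw [← hc v, ← Set.InjOn.ncard_image (f := fun e : G.Dart => e.snd)]
  · congr 1
    ext w
    constructor
    · rintro ⟨e, rfl, rfl⟩
      exact e.adj
    · intro h
      exact ⟨⟨(v, w), h⟩, rfl, rfl⟩
  · rintro e (he : e.fst = v) f (hf : f.fst = v) (h : e.snd = f.snd)
    exact Dart.ext _ _ (Prod.ext (he.trans hf.symm) h)

lemma card_dart_of_isCubic [Fintype V] [DecidableRel G.Adj] (hc : IsCubic G) :
    Fintype.card G.Dart = 3 * Fintype.card V := by
  classical
  rw [dart_card_eq_sum_degrees, Finset.sum_congr rfl (g := fun _ => 3)]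
  · simp [mul_comm]
  · intro v _
    rw [← card_neighborSet_eq_degree, ← hc v, Set.ncard_eq_toFinset_card', Set.toFinset_card]

lemma ncard_edgeSet_eq_of_isCubic [Fintype V] (hc : IsCubic G) :
    2 * G.edgeSet.ncard = 3 * Fintype.card V := by
  classical
  rw [← card_dart_of_isCubic hc, dart_card_eq_twice_card_edges, ← coe_edgeFinset,
    Set.ncard_coe_finset]

end SimpleGraph

lemma Equiv.Perm.exists_iterate_eq_of_sameCycle {α : Type*} [Finite α] {f : Equiv.Perm α} {x y : α}
    (h : f.SameCycle x y) : ∃ n < Function.minimalPeriod f x, f^[n] x = y := by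
  obtain ⟨n, -, -, hn⟩ := h.exists_pow_eq''
  refine ⟨n % Function.minimalPeriod f x, Nat.mod_lt _ ?_, ?_⟩
  · exact Function.minimalPeriod_pos_of_mem_periodicPts
      (Function.Injective.mem_periodicPts f.injective x)
  · rw [Function.iterate_mod_minimalPeriod_eq, ← hn, Equiv.Perm.coe_pow]

lemma Equiv.Perm.ncard_setOf_sameCycle {α : Type*} [Finite α] (f : Equiv.Perm α) (x : α) :
    {y | f.SameCycle x y}.ncard = Function.minimalPeriod f x := by
  have : {y | f.SameCycle x y} = (f^[·] x) '' Set.Iio (Function.minimalPeriod f x) := by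
    ext y
    constructor
    · intro h
      obtain ⟨n, hn, hy⟩ := exists_iterate_eq_of_sameCycle h
      exact ⟨n, hn, hy⟩
    · rintro ⟨n, -, rfl⟩
      exact ⟨n, by simp [Equiv.Perm.coe_pow]⟩
  rw [this, Function.iterate_injOn_Iio_minimalPeriod.ncard_image]
  simp [Set.ncard_eq_toFinset_card']

lemma Matrix.card_le_rank_add_one_of_mulVec_eq_zero {K m n : Type*} [Field K] [Fintype n]
    [Finite m] (M : Matrix m n K) (h : ∀ x, M.mulVec x = 0 → ∀ i j, x i = x j) :
    Fintype.card n ≤ M.rank + 1 := by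
  have hker : Module.finrank K (LinearMap.ker M.mulVecLin) ≤ 1 := by
    have hle : LinearMap.ker M.mulVecLin ≤ Submodule.span K {fun _ => (1 : K)} := by
      intro x hx
      rw [Submodule.mem_span_singleton]
      rcases isEmpty_or_nonempty n with hn | ⟨⟨i⟩⟩
      · exact ⟨0, Subsingleton.elim _ _⟩
      · refine ⟨x i, funext fun j => ?_⟩
        simpa using h x (by simpa using hx) i j
    exact (Submodule.finrank_mono hle).trans (finrank_span_le_card _ |>.trans (by simp))
  have := LinearMap.finrank_range_add_finrank_ker M.mulVecLin
  rw [Module.finrank_fintype_fun_eq_card] at this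
  rw [Matrix.rank]
  lia

namespace PlaneEmbedding

variable {V : Type*} {G : SimpleGraph V} (E : PlaneEmbedding G)

lemma facePerm_apply (d : G.Dart) : E.facePerm d = E.rot d.symm := rfl

lemma fst_facePerm (d : G.Dart) : (E.facePerm d).fst = d.snd := E.rot_tail d.symm

lemma mem_faceOf_self (d : G.Dart) : d ∈ E.faceOf d := Equiv.Perm.SameCycle.refl _ _

lemma faceOf_eq_of_mem {d e : G.Dart} (h : e ∈ E.faceOf d) : E.faceOf e = E.faceOf d :=
  Set.ext fun _ => ⟨fun h' => Equiv.Perm.SameCycle.trans h h',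
    fun h' => Equiv.Perm.SameCycle.trans (Equiv.Perm.SameCycle.symm h) h'⟩

lemma faceOf_facePerm (d : G.Dart) : E.faceOf (E.facePerm d) = E.faceOf d :=
  E.faceOf_eq_of_mem ⟨1, by simp⟩

lemma faceOf_iterate_facePerm (d : G.Dart) (n : ℕ) : E.faceOf (E.facePerm^[n] d) = E.faceOf d :=
  E.faceOf_eq_of_mem ⟨n, by simp [Equiv.Perm.coe_pow]⟩

lemma faceOf_rot (d : G.Dart) : E.faceOf (E.rot d) = E.faceOf d.symm :=
  E.faceOf_facePerm d.symm

/-- The number of darts on the face containing a given dart. -/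
noncomputable def faceLength (d : G.Dart) : ℕ := (E.faceOf d).ncard

lemma faceLength_eq_minimalPeriod [Finite V] (d : G.Dart) :
    E.faceLength d = Function.minimalPeriod E.facePerm d :=
  have : Finite G.Dart := Finite.of_injective _ Dart.toProd_injective
  Equiv.Perm.ncard_setOf_sameCycle _ _

lemma faceLength_congr {d e : G.Dart} (h : E.faceOf d = E.faceOf e) :
    E.faceLength d = E.faceLength e := congrArg Set.ncard h

lemma minimalPeriod_rot [Finite V] (hc : IsCubic G) (d : G.Dart) :
    Function.minimalPeriod E.rot d = 3 := by
  have : Finite G.Dart := Finite.of_injective _ Dart.toProd_injective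
  rw [← Equiv.Perm.ncard_setOf_sameCycle, ← ncard_setOf_dart_fst hc d.fst]
  congr 1
  ext e
  constructor
  · intro h
    obtain ⟨n, -, rfl⟩ := Equiv.Perm.exists_iterate_eq_of_sameCycle h
    clear h
    induction n with
    | zero => rfl
    | succ n ih =>
      rw [Function.iterate_succ_apply']
      exact (E.rot_tail _).trans ih
  · intro h
    obtain ⟨n, hn⟩ := E.rot_orbit d e (Eq.symm h)
    exact ⟨n, by simpa using hn⟩

lemma rot_ne [Finite V] (hc : IsCubic G) (d : G.Dart) : E.rot d ≠ d := by
  intro h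
  have := Function.IsPeriodicPt.minimalPeriod_le (n := 1) (f := E.rot) (x := d) (by lia) h
  rw [E.minimalPeriod_rot hc] at this
  lia

lemma rot_rot_ne [Finite V] (hc : IsCubic G) (d : G.Dart) : E.rot (E.rot d) ≠ d := by
  intro h
  have := Function.IsPeriodicPt.minimalPeriod_le (n := 2) (f := E.rot) (x := d) (by lia) h
  rw [E.minimalPeriod_rot hc] at this
  lia

lemma rot_rot_rot [Finite V] (hc : IsCubic G) (d : G.Dart) : E.rot (E.rot (E.rot d)) = d := by
  have := Function.iterate_minimalPeriod (f := E.rot) (x := d)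
  rwa [E.minimalPeriod_rot hc] at this

lemma eq_or_of_fst_eq [Finite V] (hc : IsCubic G) {d e : G.Dart} (h : d.fst = e.fst) :
    e = d ∨ e = E.rot d ∨ e = E.rot (E.rot d) := by
  have : Finite G.Dart := Finite.of_injective _ Dart.toProd_injective
  obtain ⟨n, hn⟩ := E.rot_orbit d e h
  obtain ⟨m, hm, rfl⟩ := Equiv.Perm.exists_iterate_eq_of_sameCycle
    (f := E.rot) (x := d) (y := e) ⟨n, by simpa using hn⟩
  rw [E.minimalPeriod_rot hc] at hm
  interval_cases m <;> simp

/-- Consecutive edges of a face and the opposite face at their common vertex: the three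
neighbours of the vertex are distinct. -/
lemma fst_ne_snd_facePerm_symm [Finite V] (hc : IsCubic G) {d g : G.Dart} (h : E.facePerm g = d) :
    g.fst ≠ (E.facePerm d.symm).snd := by
  intro h'
  refine E.rot_rot_ne hc g.symm ?_
  rw [← facePerm_apply, h, ← d.symm_symm, ← facePerm_apply]
  refine Dart.ext _ _ (Prod.ext ?_ h'.symm)
  subst h
  exact (E.fst_facePerm _).trans (E.fst_facePerm g)

/-- The number of faces is the sum over the darts of the reciprocals of the face lengths. -/
lemma ncard_faces_eq_sum [Finite V] [Fintype G.Dart] :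
    (E.faces.ncard : ℚ) = ∑ d : G.Dart, (1 : ℚ) / E.faceLength d := by
  classical
  have himg : E.faces = ((Finset.univ.image E.faceOf : Finset (Set G.Dart)) : Set (Set G.Dart)) := by
    ext s
    simp [faces, eq_comm]
  rw [himg, Set.ncard_coe_finset, ← Finset.sum_fiberwise_of_maps_to
    (s := Finset.univ) (t := Finset.univ.image E.faceOf) (g := E.faceOf)
    (fun d _ => Finset.mem_image_of_mem _ (Finset.mem_univ d)), Finset.cast_card]
  refine Finset.sum_congr rfl fun s hs => ?_
  obtain ⟨d, -, rfl⟩ := Finset.mem_image.1 hs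
  have hset : (({e | E.faceOf e = E.faceOf d} : Finset G.Dart) : Set G.Dart) = E.faceOf d := by
    ext e
    simp only [Finset.coe_filter, Finset.mem_univ, true_and, Set.mem_ofPred_eq]
    exact ⟨fun h => h ▸ E.mem_faceOf_self e, E.faceOf_eq_of_mem⟩
  have hcard : ({e | E.faceOf e = E.faceOf d} : Finset G.Dart).card = E.faceLength d := by
    rw [← Set.ncard_coe_finset, hset, faceLength]
  rw [Finset.sum_congr rfl (g := fun _ => (1 : ℚ) / E.faceLength d)]
  · rw [Finset.sum_const, hcard, nsmul_eq_mul, mul_one_div_cancel]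
    rw [← hcard, Nat.cast_ne_zero, Finset.card_ne_zero]
    exact ⟨d, by simp⟩
  · intro e he
    rw [E.faceLength_congr (Finset.mem_filter.1 he).2]

open Matrix in
/-- In a spherical map of a 3-connected cubic graph, the two sides of an edge are different. -/
lemma faceOf_ne_faceOf_symm [Finite V] (h3 : IsThreeConnected G) (hc : IsCubic G)
    (hconn : G.Connected) (hE : E.IsSpherical) (d₀ : G.Dart) :
    E.faceOf d₀ ≠ E.faceOf d₀.symm := by
  intro heq
  classical
  have := Fintype.ofFinite V
  have : Fintype E.faces := Fintype.ofFinite _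
  let K := ZMod 2
  let edges := G.edgeFinset.erase d₀.edge
  let A : Matrix V edges K := fun v e => if v ∈ e.1 then 1 else 0
  let B : Matrix edges E.faces K := fun e f =>
    ∑ d : G.Dart with d.edge = e.1, if d ∈ f.1 then 1 else 0
  have hedge (d : G.Dart) : (Finset.univ.filter fun d' : G.Dart => d'.edge = d.edge) = {d, d.symm} :=
    d.edge_fiber
  have hAB : A * B = 0 := by
    ext v f
    obtain ⟨_, g, rfl⟩ := f
    have hmem (d e : G.Dart) (h : E.faceOf d = E.faceOf e) :
        d ∈ E.faceOf g ↔ e ∈ E.faceOf g :=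
      ⟨fun hd => E.faceOf_eq_of_mem hd ▸ h ▸ E.mem_faceOf_self e,
        fun he => E.faceOf_eq_of_mem he ▸ h ▸ E.mem_faceOf_self d⟩
    have h0 : (∑ d : G.Dart with d.edge = d₀.edge, if d ∈ E.faceOf g then (1 : K) else 0) = 0 := by
      rw [hedge, Finset.sum_pair d₀.symm_ne.symm]
      simp only [hmem _ _ heq]
      exact CharTwo.add_self_eq_zero _
    have hsum : (∑ d : G.Dart, if d ∈ E.faceOf g then (if v = d.snd then (1 : K) else 0) else 0)
        = ∑ d : G.Dart, if d ∈ E.faceOf g then (if v = d.fst then (1 : K) else 0) else 0 := by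
      rw [← Equiv.sum_comp E.facePerm
        (fun d : G.Dart => if d ∈ E.faceOf g then (if v = d.fst then (1 : K) else 0) else 0)]
      refine Finset.sum_congr rfl fun d _ => ?_
      simp only [fst_facePerm, hmem _ _ (E.faceOf_facePerm d)]
    calc (A * B) v ⟨_, g, rfl⟩
        = ∑ e ∈ edges, (if v ∈ e then 1 else 0) *
            ∑ d : G.Dart with d.edge = e, if d ∈ E.faceOf g then (1 : K) else 0 :=
          Finset.sum_coe_sort edges (fun e => (if v ∈ e then (1 : K) else 0) *
            ∑ d : G.Dart with d.edge = e, if d ∈ E.faceOf g then (1 : K) else 0)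
      _ = ∑ e ∈ G.edgeFinset, (if v ∈ e then 1 else 0) *
            ∑ d : G.Dart with d.edge = e, if d ∈ E.faceOf g then (1 : K) else 0 :=
          Finset.sum_erase _ (by rw [h0, mul_zero])
      _ = ∑ e ∈ G.edgeFinset, ∑ d : G.Dart with d.edge = e,
            if d ∈ E.faceOf g then (if v ∈ d.edge then (1 : K) else 0) else 0 := by
          refine Finset.sum_congr rfl fun e _ => ?_
          rw [Finset.mul_sum]
          refine Finset.sum_congr rfl fun d hd => ?_
          rw [(Finset.mem_filter.1 hd).2]
          simp
      _ = ∑ d : G.Dart, if d ∈ E.faceOf g then (if v ∈ d.edge then (1 : K) else 0) else 0 :=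
          Finset.sum_fiberwise_of_maps_to (fun d _ => by simp) _
      _ = ∑ d : G.Dart, ((if d ∈ E.faceOf g then (if v = d.fst then (1 : K) else 0) else 0)
            + if d ∈ E.faceOf g then (if v = d.snd then (1 : K) else 0) else 0) := by
          refine Finset.sum_congr rfl fun d _ => ?_
          have := d.fst_ne_snd
          by_cases h1 : v = d.fst <;> by_cases h2 : v = d.snd <;> simp_all [Dart.edge]
      _ = 0 := by rw [Finset.sum_add_distrib, hsum, CharTwo.add_self_eq_zero]
  have hA : Fintype.card V ≤ Aᵀ.rank + 1 := by
    refine Matrix.card_le_rank_add_one_of_mulVec_eq_zero _ fun ψ hψ => ?_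
    refine eq_of_forall_adj_ne_edge h3 hc d₀.edge ψ fun u v huv hne => ?_
    have : ∑ x, (if x ∈ s(u, v) then (1 : K) else 0) * ψ x = 0 :=
      congrFun hψ ⟨s(u, v), by simp [edges, hne, huv]⟩
    have hfil : (Finset.univ.filter fun x => x = u ∨ x = v) = {u, v} := by ext; simp
    simp only [Sym2.mem_iff, ite_mul, one_mul, zero_mul, ← Finset.sum_filter, hfil,
      Finset.sum_pair huv.ne] at this
    exact CharTwo.add_eq_zero.1 this
  have hB : Fintype.card E.faces ≤ B.rank + 1 := by
    refine Matrix.card_le_rank_add_one_of_mulVec_eq_zero _ fun φ hφ => ?_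
    let χ : G.Dart → K := fun d => φ ⟨E.faceOf d, d, rfl⟩
    have hface (d e : G.Dart) (h : E.faceOf d = E.faceOf e) : χ d = χ e := by
      simp only [χ, h]
    have hsymm (d : G.Dart) : χ d = χ d.symm := by
      by_cases hd : d.edge = d₀.edge
      · rcases (dart_edge_eq_iff _ _).1 hd with rfl | rfl
        · exact hface _ _ heq
        · rw [Dart.symm_symm]
          exact (hface _ _ heq).symm
      · have := congrFun hφ ⟨d.edge, by simp [edges, hd]⟩
        have hval (d : G.Dart) :
            (∑ f : E.faces, (if d ∈ f.1 then (1 : K) else 0) * φ f) = χ d := by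
          rw [Finset.sum_eq_single ⟨E.faceOf d, d, rfl⟩]
          · simp [E.mem_faceOf_self, χ]
          · rintro ⟨_, g, rfl⟩ - hg
            rw [if_neg, zero_mul]
            intro h
            exact hg (Subtype.ext (E.faceOf_eq_of_mem h).symm)
          · simp
        simp only [mulVec, dotProduct, B, hedge, Finset.sum_pair d.symm_ne.symm, add_mul,
          Finset.sum_add_distrib, hval] at this
        exact CharTwo.add_eq_zero.1 this
    have hrot (d : G.Dart) : χ (E.rot d) = χ d :=
      (hface _ _ (E.faceOf_rot d)).trans (hsymm d).symm
    have hfst (d e : G.Dart) (h : d.fst = e.fst) : χ e = χ d := by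
      rcases E.eq_or_of_fst_eq hc h with rfl | rfl | rfl <;> simp [hrot]
    have hall (e : G.Dart) : χ e = χ d₀ := by
      refine hconn.preconnected.induction_of_adj
        (P := fun v => ∀ e : G.Dart, e.fst = v → χ e = χ d₀) (a := d₀.fst) ?_ ?_ e.fst e rfl
      · intro u v huv hu e he
        let d : G.Dart := ⟨(u, v), huv⟩
        rw [hfst d.symm e he.symm, ← hsymm, hu d rfl]
      · intro e he
        exact hfst _ _ he.symm
    rintro ⟨_, g, rfl⟩ ⟨_, g', rfl⟩
    exact (hall g).trans (hall g').symm
  have hrank := Matrix.rank_add_rank_le_card_of_mul_eq_zero hAB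
  rw [Matrix.rank_transpose] at hA
  have hpos : 0 < G.edgeFinset.card := Finset.card_pos.2 ⟨d₀.edge, by simp⟩
  have hcard : Fintype.card edges = G.edgeFinset.card - 1 := by
    rw [Fintype.card_coe, Finset.card_erase_of_mem (by simp)]
  have hEuler := hE
  rw [IsSpherical, Set.ncard_univ, Nat.card_eq_fintype_card, ← coe_edgeFinset,
    Set.ncard_coe_finset, ← Nat.card_coe_set_eq, Nat.card_eq_fintype_card] at hEuler
  lia

lemma three_le_faceLength [Finite V] (hc : IsCubic G) (d : G.Dart) : 3 ≤ E.faceLength d := by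
  have : Finite G.Dart := Finite.of_injective _ Dart.toProd_injective
  rw [faceLength_eq_minimalPeriod]
  by_contra! hlt
  have hpos : 0 < Function.minimalPeriod E.facePerm d :=
    Function.minimalPeriod_pos_of_mem_periodicPts (E.facePerm.injective.mem_periodicPts d)
  have hper := Function.iterate_minimalPeriod (f := E.facePerm) (x := d)
  generalize Function.minimalPeriod E.facePerm d = p at *
  obtain rfl | rfl : p = 1 ∨ p = 2 := by lia
  · have h : E.facePerm d = d := hper
    have := E.fst_facePerm d
    rw [h] at this
    exact d.fst_ne_snd this
  · have h : E.facePerm (E.facePerm d) = d := hper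
    have h1 := E.fst_facePerm d
    have h2 := E.fst_facePerm (E.facePerm d)
    rw [h] at h2
    exact E.rot_ne hc d.symm (Dart.ext _ _ (Prod.ext h1 h2.symm))

/-- A face of length three, presented by its third vertex. -/
lemma exists_of_faceLength_eq_three [Finite V] {d : G.Dart} (h : E.faceLength d = 3) :
    ∃ g x, E.facePerm g = d ∧ (E.facePerm d).snd = x ∧ g.fst = x ∧
      G.Adj d.snd x ∧ G.Adj x d.fst := by
  have hper := Function.iterate_minimalPeriod (f := E.facePerm) (x := d)
  rw [← faceLength_eq_minimalPeriod, h] at hper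
  have hper' : E.facePerm (E.facePerm (E.facePerm d)) = d := hper
  refine ⟨_, _, hper', rfl, E.fst_facePerm _, ?_, ?_⟩
  · have := (E.facePerm d).adj
    rwa [fst_facePerm] at this
  · have := (E.facePerm (E.facePerm d)).adj
    rwa [← fst_facePerm, hper', fst_facePerm] at this

lemma eq_of_faceOf_eq_of_fst_eq [Finite V] {E : PlaneEmbedding G} (hc : IsCubic G)
    (hside : ∀ d : G.Dart, E.faceOf d ≠ E.faceOf d.symm) {d e : G.Dart} (h : E.faceOf d = E.faceOf e)
    (hfst : d.fst = e.fst) : d = e := by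
  rcases E.eq_or_of_fst_eq hc hfst with rfl | rfl | rfl
  · rfl
  · rw [faceOf_rot] at h
    exact absurd h (hside d)
  · refine absurd ?_ (hside (E.rot (E.rot d)))
    rw [← faceOf_rot, E.rot_rot_rot hc, h]

lemma fst_iterate_facePerm_injOn [Finite V] {E : PlaneEmbedding G} (hc : IsCubic G)
    (hside : ∀ d : G.Dart, E.faceOf d ≠ E.faceOf d.symm) (d : G.Dart) :
    (Set.Iio (E.faceLength d)).InjOn fun n => (E.facePerm^[n] d).fst := by
  rw [faceLength_eq_minimalPeriod]
  intro m hm n hn hmn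
  refine Function.iterate_injOn_Iio_minimalPeriod hm hn
    (eq_of_faceOf_eq_of_fst_eq hc hside ?_ hmn)
  rw [faceOf_iterate_facePerm, faceOf_iterate_facePerm]

lemma faceLength_mem_cycleLengths [Finite V] {E : PlaneEmbedding G} (hc : IsCubic G)
    (hside : ∀ d : G.Dart, E.faceOf d ≠ E.faceOf d.symm) (d : G.Dart) : E.faceLength d ∈ CycleLengths G := by
  obtain ⟨n, hn⟩ := Nat.exists_eq_add_of_le' (E.three_le_faceLength hc d)
  have hinj := fst_iterate_facePerm_injOn hc hside d
  have hper := E.faceLength_eq_minimalPeriod d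
  rw [hn] at hinj hper ⊢
  refine add_three_mem_cycleLengths (fun i => (E.facePerm^[i] d).fst) ?_ ?_
  · intro i j hij
    exact Fin.ext (hinj i.2 j.2 hij)
  · intro i
    have : E.facePerm^[(i + 1 : Fin (n + 3))] d = E.facePerm (E.facePerm^[i] d) := by
      rw [← Function.iterate_succ_apply' E.facePerm,
        ← Function.iterate_mod_minimalPeriod_eq (n := (i : ℕ).succ), ← hper, Fin.val_add]
      simp
    simp only [this, fst_facePerm]
    exact (E.facePerm^[i] d).adj

/-- A face of length four, presented by its third and fourth vertices. -/
lemma exists_of_faceLength_eq_four [Finite V] {E : PlaneEmbedding G} (hc : IsCubic G)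
    (hside : ∀ d : G.Dart, E.faceOf d ≠ E.faceOf d.symm) {d : G.Dart} (h : E.faceLength d = 4) :
    ∃ g x w, E.facePerm g = d ∧ (E.facePerm d).snd = x ∧ g.fst = w ∧
      G.Adj d.snd x ∧ G.Adj x w ∧ G.Adj w d.fst ∧ x ≠ d.fst ∧ w ≠ d.snd := by
  have hper := Function.iterate_minimalPeriod (f := E.facePerm) (x := d)
  rw [← faceLength_eq_minimalPeriod, h] at hper
  have hper' : E.facePerm (E.facePerm (E.facePerm (E.facePerm d))) = d := hper
  have hinj := fst_iterate_facePerm_injOn hc hside d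
  rw [h] at hinj
  refine ⟨_, _, _, hper', rfl, E.fst_facePerm _, ?_, ?_, ?_, ?_, ?_⟩
  · have := (E.facePerm d).adj
    rwa [fst_facePerm] at this
  · have := (E.facePerm (E.facePerm d)).adj
    rwa [fst_facePerm] at this
  · have := (E.facePerm (E.facePerm (E.facePerm d))).adj
    rwa [← fst_facePerm, hper', fst_facePerm] at this
  · exact fun heq => absurd (@hinj 2 (by simp) 0 (by simp) ((E.fst_facePerm _).trans heq)) (by simp)
  · exact fun heq => absurd (@hinj 3 (by simp) 1 (by simp)
      ((E.fst_facePerm _).trans (heq.trans (E.fst_facePerm d).symm))) (by simp)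

lemma five_mem_cycleLengths_of_faceLength [Finite V] {E : PlaneEmbedding G} (hc : IsCubic G)
    (hside : ∀ d : G.Dart, E.faceOf d ≠ E.faceOf d.symm) {d : G.Dart} (h : E.faceLength d = 3)
    (h' : E.faceLength d.symm = 4) : 5 ∈ CycleLengths G := by
  obtain ⟨g, x, hg, hdx, hgx, hbx, hxa⟩ := E.exists_of_faceLength_eq_three h
  obtain ⟨g', y, z, hg', hdy, hgz, hay, hyz, hzb, hyb, hza⟩ :=
    exists_of_faceLength_eq_four hc hside h'
  have h1 : x ≠ y := by
    rw [← hgx, ← hdy]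
    exact E.fst_ne_snd_facePerm_symm hc hg
  have h2 : z ≠ x := by
    rw [← hgz, ← hdx, ← d.symm_symm]
    exact E.fst_ne_snd_facePerm_symm hc hg'
  change G.Adj d.fst y at hay
  change G.Adj z d.snd at hzb
  change y ≠ d.snd at hyb
  change z ≠ d.fst at hza
  refine five_mem_cycleLengths (a := d.fst) (b := x) (c := d.snd) (d := z) (e := y) ?_
    hxa.symm hbx.symm hzb.symm hyz.symm hay.symm
  have := d.fst_ne_snd
  simp [hxa.ne', hbx.ne', this, hza.symm, hay.ne, hyb.symm, hzb.ne', hyz.ne', h1, h2.symm]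

/-- Two faces of length at most four sharing an edge yield a cycle of length five or six. -/
lemma not_faceLength_le_four_of_symm [Fintype V] {E : PlaneEmbedding G} (h3 : IsThreeConnected G)
    (hc : IsCubic G) (hside : ∀ d : G.Dart, E.faceOf d ≠ E.faceOf d.symm)
    (hcard : 5 ≤ Fintype.card V) (h5 : 5 ∉ CycleLengths G) (h6 : 6 ∉ CycleLengths G)
    (d : G.Dart) (hd : E.faceLength d ≤ 4) (hd' : E.faceLength d.symm ≤ 4) : False := by
  have hlow := E.three_le_faceLength hc d
  have hlow' := E.three_le_faceLength hc d.symm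
  obtain h | h : E.faceLength d = 3 ∨ E.faceLength d = 4 := by lia
  all_goals obtain h' | h' : E.faceLength d.symm = 3 ∨ E.faceLength d.symm = 4 := by lia
  · obtain ⟨g, x, hg, hdx, hgx, hbx, hxa⟩ := E.exists_of_faceLength_eq_three h
    obtain ⟨g', y, hg', hdy, hgy, hay, hyb⟩ := E.exists_of_faceLength_eq_three h'
    have h1 : x ≠ y := by
      rw [← hgx, ← hdy]
      exact E.fst_ne_snd_facePerm_symm hc hg
    exact false_of_triangles_share_edge h3 hc hcard d.adj hxa.symm hbx hay hyb.symm h1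
  · exact h5 (five_mem_cycleLengths_of_faceLength hc hside h h')
  · exact h5 (five_mem_cycleLengths_of_faceLength hc hside h' (d.symm_symm.symm ▸ h))
  · obtain ⟨g, x, w, hg, hdx, hgw, hbx, hxw, hwa, hxa, hwb⟩ :=
      exists_of_faceLength_eq_four hc hside h
    obtain ⟨g', y, z, hg', hdy, hgz, hay, hyz, hzb, hyb, hza⟩ :=
      exists_of_faceLength_eq_four hc hside h'
    have h1 : w ≠ y := by
      rw [← hgw, ← hdy]
      exact E.fst_ne_snd_facePerm_symm hc hg
    have h2 : z ≠ x := by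
      rw [← hgz, ← hdx, ← d.symm_symm]
      exact E.fst_ne_snd_facePerm_symm hc hg'
    change G.Adj d.fst y at hay
    change G.Adj z d.snd at hzb
    change y ≠ d.snd at hyb
    change z ≠ d.fst at hza
    have hab := d.fst_ne_snd
    by_cases hxy : x = y
    · subst hxy
      obtain rfl : z = w := by
        have := eq_of_adj_of_isCubic hc hay.symm hbx.symm hxw hyz hab hwa.ne' hwb.symm
        have := hzb.ne
        tauto
      exact false_of_triangles_share_edge h3 hc hcard d.adj hay hbx hwa.symm hzb.symm h1.symm
    by_cases hwz : w = z
    · subst hwz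
      have := eq_of_adj_of_isCubic hc hwa hzb hxw.symm hyz.symm hab hxa.symm hbx.ne
      have := hay.ne
      tauto
    refine h6 (six_mem_cycleLengths (a := d.fst) (b := w) (c := x) (d := d.snd) (e := z) (f := y)
      ?_ hwa.symm hxw.symm hbx.symm hzb.symm hyz.symm hay.symm)
    simp [hwa.ne', hxa.symm, hab, hza.symm, hay.ne, hxw.ne', hwb, hwz, h1, hbx.ne', h2.symm, hxy,
      hzb.ne', hyb.symm, hyz.ne']

/-- If two faces of length at most four never share an edge and every longer face has length at
least twelve, then a cubic map has at most half as many faces as vertices. -/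
lemma two_mul_ncard_faces_le [Fintype V] (hc : IsCubic G)
    (hsmall : ∀ d : G.Dart, E.faceLength d ≤ 4 → ¬ E.faceLength d.symm ≤ 4)
    (hlarge : ∀ d : G.Dart, 4 < E.faceLength d → 12 ≤ E.faceLength d) :
    2 * E.faces.ncard ≤ Fintype.card V := by
  classical
  let g : G.Dart → ℚ := fun d => 1 / E.faceLength d
  have h_three (d : G.Dart) : g d ≤ 1 / 3 :=
    one_div_le_one_div_of_le (by norm_num) (by exact_mod_cast E.three_le_faceLength hc d)
  have h_twelve (d : G.Dart) (h : ¬ E.faceLength d ≤ 4) : g d ≤ 1 / 12 :=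
    one_div_le_one_div_of_le (by norm_num) (by exact_mod_cast hlarge d (by lia))
  have hpair (d : G.Dart) : ¬ (E.faceLength d ≤ 4 ∧ E.faceLength (E.rot d) ≤ 4) := by
    rintro ⟨h, h'⟩
    rw [E.faceLength_congr (E.faceOf_rot d)] at h'
    exact hsmall d h h'
  have hcorner (d : G.Dart) : g d + g (E.rot d) + g (E.rot (E.rot d)) ≤ 1 / 2 := by
    have h1 := hpair d
    have h2 := hpair (E.rot d)
    have h3 := hpair (E.rot (E.rot d))
    rw [E.rot_rot_rot hc] at h3
    have t1 := h_three d
    have t2 := h_three (E.rot d)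
    have t3 := h_three (E.rot (E.rot d))
    have s1 := h_twelve d
    have s2 := h_twelve (E.rot d)
    have s3 := h_twelve (E.rot (E.rot d))
    by_cases c1 : E.faceLength d ≤ 4
    · have := s2 (by tauto)
      have := s3 (by tauto)
      linarith
    · have := s1 c1
      by_cases c2 : E.faceLength (E.rot d) ≤ 4
      · have := s3 (by tauto)
        linarith
      · have := s2 c2
        linarith
  have hsum : 3 * ∑ d, g d ≤ ∑ _d : G.Dart, (1 / 2 : ℚ) := by
    have e1 : ∑ d, g (E.rot d) = ∑ d, g d := Equiv.sum_comp E.rot g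
    have e2 : ∑ d, g (E.rot (E.rot d)) = ∑ d, g d :=
      (Equiv.sum_comp E.rot fun d => g (E.rot d)).trans e1
    calc 3 * ∑ d, g d = ∑ d, (g d + g (E.rot d) + g (E.rot (E.rot d))) := by
          rw [Finset.sum_add_distrib, Finset.sum_add_distrib, e1, e2]
          ring
      _ ≤ _ := Finset.sum_le_sum fun d _ => hcorner d
  rw [← E.ncard_faces_eq_sum, Finset.sum_const, Finset.card_univ, card_dart_of_isCubic hc,
    nsmul_eq_mul] at hsum
  push_cast at hsum
  have : (2 : ℚ) * E.faces.ncard ≤ Fintype.card V := by linarith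
  exact_mod_cast this

end PlaneEmbedding

/-- Merker's conjecture holds for `k = 5`: every 3-connected cubic planar graph
of circumference at least 5 has a cycle of length `ℓ` with `5 ≤ ℓ ≤ 12`. -/
theorem statement4 (V : Type) [Fintype V] (G : SimpleGraph V)
    (h3 : IsThreeConnected G) (hc : IsCubic G) (hp : IsPlanar G)
    (hcirc : CircumferenceAtLeast G 5) :
    ∃ ℓ ∈ CycleLengths G, 5 ≤ ℓ ∧ ℓ ≤ 12 := by
  obtain ⟨hconn, E, hE⟩ := hp
  by_contra! hno
  have hside := E.faceOf_ne_faceOf_symm h3 hc hconn hE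
  have hsmall := PlaneEmbedding.not_faceLength_le_four_of_symm h3 hc hside
    (le_card_of_circumferenceAtLeast hcirc)
    (fun h => absurd (hno 5 h le_rfl) (by lia)) (fun h => absurd (hno 6 h (by lia)) (by lia))
  have hfaces := E.two_mul_ncard_faces_le hc hsmall fun d hd =>
    (hno _ (PlaneEmbedding.faceLength_mem_cycleLengths hc hside d) hd).le
  have hedges := ncard_edgeSet_eq_of_isCubic hc
  rw [PlaneEmbedding.IsSpherical, Set.ncard_univ, Nat.card_eq_fintype_card] at hE
  lia
end

section
/- There exist infinitely many even integers k for which Merker's conjecture fails: for each such k there is a 3-connected cubic planar graph of circumference at least k whose cycle spectrum contains no element of [k, 2k+2]. -/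
open SimpleGraph

/-- A simple cubic combinatorial map on the vertex set `V`: every vertex has three ports, cyclically
ordered, and `opp` matches the ports along the edges. -/
structure CubicMap (V : Type) where
  opp : V × Fin 3 → V × Fin 3
  opp_opp : ∀ x, opp (opp x) = x
  opp_ne : ∀ v i, (opp (v, i)).1 ≠ v
  opp_inj : ∀ v i j, (opp (v, i)).1 = (opp (v, j)).1 → i = j

namespace CubicMap

variable {V : Type} (M : CubicMap V)

/-- The face successor of a port. -/
def next (x : V × Fin 3) : V × Fin 3 := ((M.opp x).1, (M.opp x).2 + 1)

/-- The permutation of the ports whose orbits are the faces. -/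
def face : Equiv.Perm (V × Fin 3) where
  toFun := M.next
  invFun x := M.opp (x.1, x.2 + 2)
  left_inv x := by simp [next, add_assoc, M.opp_opp]
  right_inv x := by simp [next, add_assoc, M.opp_opp]

@[simp] lemma face_apply (x : V × Fin 3) :
    M.face x = ((M.opp x).1, (M.opp x).2 + 1) := rfl

/-- The number of faces. -/
noncomputable def numFaces : ℕ := Nat.card (Quotient (Equiv.Perm.SameCycle.setoid M.face))

/-- Any colouring of the vertices that is constant along all edges avoiding two given vertices is
constant away from these vertices. -/
def Conn : Prop :=
  ∀ a b : V, ∀ f : V → Prop,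
    (∀ v i, v ≠ a → v ≠ b → (M.opp (v, i)).1 ≠ a → (M.opp (v, i)).1 ≠ b →
      (f v ↔ f (M.opp (v, i)).1)) →
    ∀ u v, u ≠ a → u ≠ b → v ≠ a → v ≠ b → (f u ↔ f v)

/-- A set of ports that is closed under `opp` and contains zero or two ports at every vertex. -/
def IsEven (z : V × Fin 3 → Bool) : Prop :=
  (∀ x, z (M.opp x) = z x) ∧ ∀ v, ((z (v, 0) ^^ z (v, 1)) ^^ z (v, 2)) = false

lemma card_quotient_sameCycle {D L : Type} (p : Equiv.Perm D) (lab : D → L) (rep : L → D)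
    (h1 : ∀ d, lab (p d) = lab d) (h2 : ∀ l, lab (rep l) = l)
    (h3 : ∀ d, p.SameCycle (rep (lab d)) d) :
    Nat.card (Quotient (Equiv.Perm.SameCycle.setoid p)) = Nat.card L := by
  have h4 : ∀ (n : ℕ) d, lab ((p ^ n) d) = lab d := by
    intro n
    induction n with
    | zero => simp
    | succ n ih => intro d; rw [pow_succ', Equiv.Perm.mul_apply, h1, ih]
  have h5 : ∀ a b, p.SameCycle a b → lab a = lab b := by
    rintro a b ⟨n, rfl⟩
    rcases n.eq_nat_or_neg with ⟨m, rfl | rfl⟩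
    · simp [h4]
    · rw [← h4 m ((p ^ (-(m : ℤ))) a)]
      simp
  refine Nat.card_congr ⟨Quotient.lift lab h5, fun l => ⟦rep l⟧, ?_, h2⟩
  intro q
  induction q using Quotient.inductionOn with
  | _ d => exact Quotient.sound (h3 d)

/-! ### Replacing a vertex by a triangle -/

section Truncation

variable (v : V)

/-- The vertex set after replacing `v` by a triangle. -/
abbrev TruncVert : Type := {u : V // u ≠ v} ⊕ Fin 3

open scoped Classical in
/-- The old ports, seen in the truncated map. -/
noncomputable def lift (x : V × Fin 3) : TruncVert v × Fin 3 :=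
  if h : x.1 = v then (Sum.inr x.2, 0) else (Sum.inl ⟨x.1, h⟩, x.2)

lemma lift_of_ne (u : V) (h : u ≠ v) (i : Fin 3) :
    lift v (u, i) = (Sum.inl ⟨u, h⟩, i) := by simp [lift, h]

@[simp] lemma lift_self (i : Fin 3) : lift v (v, i) = (Sum.inr i, 0) := by simp [lift]

lemma lift_injective : Function.Injective (lift v) := by
  rintro ⟨u, i⟩ ⟨w, j⟩ h
  by_cases hu : u = v <;> by_cases hw : w = v <;> simp_all [lift]

/-- The port matching of the truncated map. -/
noncomputable def truncOpp : TruncVert v × Fin 3 → TruncVert v × Fin 3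
  | (Sum.inl u, j) => lift v (M.opp (u.1, j))
  | (Sum.inr a, 0) => lift v (M.opp (v, a))
  | (Sum.inr a, 1) => (Sum.inr (a + 1), 2)
  | (Sum.inr a, 2) => (Sum.inr (a + 2), 1)

@[simp] lemma truncOpp_inl (u : {u : V // u ≠ v}) (j : Fin 3) :
    M.truncOpp v (Sum.inl u, j) = lift v (M.opp (u.1, j)) := rfl
@[simp] lemma truncOpp_inr_zero (a : Fin 3) :
    M.truncOpp v (Sum.inr a, 0) = lift v (M.opp (v, a)) := rfl
@[simp] lemma truncOpp_inr_one (a : Fin 3) :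
    M.truncOpp v (Sum.inr a, 1) = (Sum.inr (a + 1), 2) := rfl
@[simp] lemma truncOpp_inr_two (a : Fin 3) :
    M.truncOpp v (Sum.inr a, 2) = (Sum.inr (a + 2), 1) := rfl

lemma truncOpp_lift (x : V × Fin 3) : M.truncOpp v (lift v x) = lift v (M.opp x) := by
  obtain ⟨u, i⟩ := x
  by_cases h : u = v
  · subst h; simp
  · rw [lift_of_ne v u h]; simp

lemma lift_fst_ne_inr_self (i a : Fin 3) :
    (lift v (M.opp (v, i))).1 ≠ Sum.inr a := by
  have := M.opp_ne v i
  rw [show M.opp (v, i) = ((M.opp (v, i)).1, (M.opp (v, i)).2) from rfl, lift_of_ne v _ this]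
  simp

lemma lift_fst_eq_inl_iff (x : V × Fin 3) (u : {u : V // u ≠ v}) :
    (lift v x).1 = Sum.inl u ↔ x.1 = u.1 := by
  obtain ⟨w, i⟩ := x
  by_cases h : w = v
  · subst h; simpa using fun h => u.2 h.symm
  · rw [lift_of_ne v w h]; simp [Subtype.ext_iff]

lemma fst_eq_of_lift_fst_eq {x y : V × Fin 3} (h : (lift v x).1 = (lift v y).1) :
    x.1 = y.1 := by
  obtain ⟨u, i⟩ := x
  obtain ⟨w, j⟩ := y
  by_cases hu : u = v <;> by_cases hw : w = v <;> simp_all [lift]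

/-- The map obtained by replacing the vertex `v` by a triangle. -/
noncomputable def trunc : CubicMap (TruncVert v) where
  opp := M.truncOpp v
  opp_opp := by
    rintro ⟨u | a, j⟩
    · rw [truncOpp_inl, truncOpp_lift, M.opp_opp, lift_of_ne v _ u.2]
    · fin_cases j
      · change M.truncOpp v (M.truncOpp v (Sum.inr a, 0)) = (Sum.inr a, 0)
        rw [truncOpp_inr_zero, truncOpp_lift, M.opp_opp, lift_self]
      · change M.truncOpp v (M.truncOpp v (Sum.inr a, 1)) = (Sum.inr a, 1)
        simp [add_assoc]
      · change M.truncOpp v (M.truncOpp v (Sum.inr a, 2)) = (Sum.inr a, 2)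
        simp [add_assoc]
  opp_ne := by
    rintro (u | a) j
    · rw [truncOpp_inl, Ne, lift_fst_eq_inl_iff]
      exact M.opp_ne _ _
    · fin_cases j
      · exact M.lift_fst_ne_inr_self v a a
      · change Sum.inr (a + 1) ≠ Sum.inr a
        simp
      · change Sum.inr (a + 2) ≠ Sum.inr a
        simp
  opp_inj := by
    rintro (u | a) i j h
    · exact M.opp_inj u.1 i j (fst_eq_of_lift_fst_eq v h)
    · have h0 := M.lift_fst_ne_inr_self v a
      fin_cases i <;> fin_cases j <;> first
        | rfl
        | exact absurd h (h0 _)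
        | exact absurd h.symm (h0 _)
        | (exfalso; revert h; simp [truncOpp]; try decide)

@[simp] lemma trunc_opp : (M.trunc v).opp = M.truncOpp v := rfl

lemma trunc_conn (hM : M.Conn) : (M.trunc v).Conn := by
  intro a b f hf
  set n : Fin 3 → V := fun i => (M.opp (v, i)).1 with hn
  have hnv : ∀ i, n i ≠ v := fun i => M.opp_ne v i
  have hlift : ∀ i, lift v (M.opp (v, i)) = (Sum.inl ⟨n i, hnv i⟩, (M.opp (v, i)).2) :=
    fun i => lift_of_ne v _ (hnv i) _
  have hout : ∀ i, Sum.inr i ≠ a → Sum.inr i ≠ b → Sum.inl ⟨n i, hnv i⟩ ≠ a →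
      Sum.inl ⟨n i, hnv i⟩ ≠ b → (f (Sum.inr i) ↔ f (Sum.inl ⟨n i, hnv i⟩)) := by
    intro i h1 h2 h3 h4
    have := hf (Sum.inr i) 0 h1 h2
    simp only [trunc_opp, truncOpp_inr_zero, hlift] at this
    exact this h3 h4
  have htri : ∀ i j, Sum.inr i ≠ a → Sum.inr i ≠ b → Sum.inr j ≠ a →
      Sum.inr j ≠ b → (f (Sum.inr i) ↔ f (Sum.inr j)) := by
    have h1 : ∀ i, Sum.inr i ≠ a → Sum.inr i ≠ b → Sum.inr (i + 1) ≠ a →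
        Sum.inr (i + 1) ≠ b → (f (Sum.inr i) ↔ f (Sum.inr (i + 1))) := by
      intro i h1 h2 h3 h4
      exact hf (Sum.inr i) 1 h1 h2 h3 h4
    intro i j a1 a2 a3 a4
    have h2 : ∀ i j : Fin 3, j = i ∨ j = i + 1 ∨ i = j + 1 := by decide
    have := h2 i j
    rcases this with rfl | rfl | rfl
    · rfl
    · exact h1 i a1 a2 a3 a4
    · exact (h1 j a3 a4 a1 a2).symm
  have hin : ∀ (u : {u : V // u ≠ v}) i (h : (M.opp (u.1, i)).1 ≠ v),
      Sum.inl u ≠ a → Sum.inl u ≠ b → Sum.inl ⟨_, h⟩ ≠ a → Sum.inl ⟨_, h⟩ ≠ b →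
      (f (Sum.inl u) ↔ f (Sum.inl ⟨_, h⟩)) := by
    intro u i h h1 h2 h3 h4
    have := hf (Sum.inl u) i h1 h2
    simp only [trunc_opp, truncOpp_inl] at this
    rw [show M.opp (u.1, i) = ((M.opp (u.1, i)).1, (M.opp (u.1, i)).2) from rfl,
      lift_of_ne v _ h] at this
    exact this h3 h4
  -- colour classes on the old vertices once a triangle vertex is removed
  have hold : ∀ c : V, (∀ u : {u : V // u ≠ v}, u.1 ≠ c → Sum.inl u ≠ a ∧ Sum.inl u ≠ b) →
      ∀ u w : {u : V // u ≠ v}, u.1 ≠ c → w.1 ≠ c → (f (Sum.inl u) ↔ f (Sum.inl w)) := by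
    intro c hc u w hu hw
    have := hM v c (fun x => ∃ h : x ≠ v, f (Sum.inl ⟨x, h⟩)) ?_ u.1 w.1 u.2 hu w.2 hw
    · simpa [u.2, w.2] using this
    · intro x i h1 h2 h3 h4
      have := hin ⟨x, h1⟩ i h3 (hc _ h2).1 (hc _ h2).2 (hc _ h4).1 (hc _ h4).2
      simp only [h1, h3, ne_eq, not_false_eq_true, exists_true_left]
      exact this
  have hfin : ∀ c : V,
      (∀ u : {u : V // u ≠ v}, u.1 ≠ c ↔ Sum.inl u ≠ a ∧ Sum.inl u ≠ b) →
      (∀ i, Sum.inr i ≠ a → Sum.inr i ≠ b →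
        ∃ u : {u : V // u ≠ v}, u.1 ≠ c ∧ (f (Sum.inr i) ↔ f (Sum.inl u))) →
      ∀ x y, x ≠ a → x ≠ b → y ≠ a → y ≠ b → (f x ↔ f y) := by
    intro c hc ht
    have hrep : ∀ x, x ≠ a → x ≠ b →
        ∃ u : {u : V // u ≠ v}, u.1 ≠ c ∧ (f x ↔ f (Sum.inl u)) := by
      rintro (u | i) h1 h2
      · exact ⟨u, (hc u).2 ⟨h1, h2⟩, Iff.rfl⟩
      · exact ht i h1 h2
    intro x y h1 h2 h3 h4
    obtain ⟨u, hu, hxu⟩ := hrep x h1 h2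
    obtain ⟨w, hw, hyw⟩ := hrep y h3 h4
    rw [hxu, hyw]
    exact hold c (fun u => (hc u).1) u w hu hw
  have hmixed : ∀ (k : Fin 3) (c : {u : V // u ≠ v}),
      (∀ i, i ≠ k → Sum.inr i ≠ a ∧ Sum.inr i ≠ b) →
      (∀ u : {u : V // u ≠ v}, u.1 ≠ c ↔ Sum.inl u ≠ a ∧ Sum.inl u ≠ b) →
      ∀ i, i ≠ k → ∃ u : {u : V // u ≠ v}, u.1 ≠ c ∧ (f (Sum.inr i) ↔ f (Sum.inl u)) := by
    intro k c hk hc i hi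
    by_cases h : n i = c.1
    · obtain ⟨j, hjk, hji⟩ : ∃ j, j ≠ k ∧ j ≠ i := by
        have : ∀ i k : Fin 3, ∃ j, j ≠ k ∧ j ≠ i := by decide
        exact this i k
      have hj : n j ≠ c.1 := fun hj => hji (M.opp_inj v j i (hj.trans h.symm))
      refine ⟨⟨n j, hnv j⟩, hj, ?_⟩
      rw [htri i j (hk i hi).1 (hk i hi).2 (hk j hjk).1 (hk j hjk).2]
      exact hout j (hk j hjk).1 (hk j hjk).2 ((hc _).1 hj).1 ((hc _).1 hj).2
    · exact ⟨⟨n i, hnv i⟩, h, hout i (hk i hi).1 (hk i hi).2 ((hc ⟨n i, hnv i⟩).1 h).1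
        ((hc ⟨n i, hnv i⟩).1 h).2⟩
  rcases a with a | a <;> rcases b with b | b
  · have htri' : ∀ i, f (Sum.inr i) ↔ f (Sum.inr 0) := fun i => htri i 0 (by simp) (by simp)
      (by simp) (by simp)
    classical
    set g : V → Prop := fun x => if h : x = v then f (Sum.inr 0) else f (Sum.inl ⟨x, h⟩) with hg
    have key := hM a.1 b.1 g ?_
    · have hgl : ∀ u : {u : V // u ≠ v}, g u.1 ↔ f (Sum.inl u) := by
        intro u; simp [hg, u.2]
      have hgv : g v ↔ f (Sum.inr 0) := by simp [hg]
      rintro (u | u) (w | w) h1 h2 h3 h4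
      · have := key u.1 w.1 (by simpa [Subtype.ext_iff] using h1)
          (by simpa [Subtype.ext_iff] using h2) (by simpa [Subtype.ext_iff] using h3)
          (by simpa [Subtype.ext_iff] using h4)
        rwa [hgl, hgl] at this
      · have := key u.1 v (by simpa [Subtype.ext_iff] using h1)
          (by simpa [Subtype.ext_iff] using h2) a.2.symm b.2.symm
        rw [hgl, hgv] at this
        rw [this, htri' w]
      · have := key v w.1 a.2.symm b.2.symm (by simpa [Subtype.ext_iff] using h3)
          (by simpa [Subtype.ext_iff] using h4)
        rw [hgl, hgv] at this
        rw [htri' u, this]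
      · rw [htri' u, htri' w]
    · intro x i h1 h2 h3 h4
      by_cases hx : x = v
      · subst hx
        have h5 := hnv i
        have := hout i (by simp) (by simp) (by simpa [Subtype.ext_iff] using h3)
          (by simpa [Subtype.ext_iff] using h4)
        simp only [hg, dif_pos]
        rw [dif_neg h5, ← this, htri' i]
      · by_cases hy : (M.opp (x, i)).1 = v
        · obtain ⟨j, hj⟩ : ∃ j, M.opp (x, i) = (v, j) := ⟨_, Prod.ext hy rfl⟩
          have hxj : M.opp (v, j) = (x, i) := by rw [← hj, M.opp_opp]
          have hnj : n j = x := by simp [hn, hxj]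
          have := hout j (by simp) (by simp) (by simpa [Subtype.ext_iff, hnj] using h1)
            (by simpa [Subtype.ext_iff, hnj] using h2)
          simp only [hg, dif_neg hx, dif_pos hy]
          rw [← htri' j, this]
          simp [hnj]
        · simp only [hg, dif_neg hx, dif_neg hy]
          exact hin ⟨x, hx⟩ i hy (by simpa [Subtype.ext_iff] using h1)
            (by simpa [Subtype.ext_iff] using h2) (by simpa [Subtype.ext_iff] using h3)
            (by simpa [Subtype.ext_iff] using h4)
  · have hc : ∀ u : {u : V // u ≠ v}, u.1 ≠ a.1 ↔
        Sum.inl u ≠ (Sum.inl a : TruncVert v) ∧ Sum.inl u ≠ (Sum.inr b : TruncVert v) := by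
      simp [Subtype.ext_iff]
    refine hfin a.1 hc fun i _ h2 => hmixed b a (by simp) hc i (by simpa using h2)
  · have hc : ∀ u : {u : V // u ≠ v}, u.1 ≠ b.1 ↔
        Sum.inl u ≠ (Sum.inr a : TruncVert v) ∧ Sum.inl u ≠ (Sum.inl b : TruncVert v) := by
      simp [Subtype.ext_iff]
    refine hfin b.1 hc fun i h2 _ => hmixed a b (by simp) hc i (by simpa using h2)
  · refine hfin v (fun u => by simpa using u.2) fun i h1 h2 =>
      ⟨⟨n i, hnv i⟩, hnv i, hout i h1 h2 (by simp) (by simp)⟩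

/-- The face of the truncated map containing a port, in terms of the old faces; `none` is the new
triangle. -/
noncomputable def truncLabel :
    TruncVert v × Fin 3 → Option (Quotient (Equiv.Perm.SameCycle.setoid M.face))
  | (Sum.inl u, j) => some ⟦(u.1, j)⟧
  | (Sum.inr a, 0) => some ⟦(v, a)⟧
  | (Sum.inr a, 1) => some ⟦(v, a + 1)⟧
  | (Sum.inr _, 2) => none

lemma truncLabel_lift (x : V × Fin 3) : M.truncLabel v (lift v x) = some ⟦x⟧ := by
  obtain ⟨u, i⟩ := x
  by_cases h : u = v
  · subst h; simp [truncLabel]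
  · rw [lift_of_ne v u h]; simp [truncLabel]

lemma mk_face (x : V × Fin 3) :
    (⟦M.face x⟧ : Quotient (Equiv.Perm.SameCycle.setoid M.face)) = ⟦x⟧ :=
  Quotient.sound (Equiv.Perm.sameCycle_apply_left.2 (Equiv.Perm.SameCycle.refl _ _))

lemma trunc_face_one (a : Fin 3) :
    (M.trunc v).face (Sum.inr a, 1) = (Sum.inr (a + 1), 0) := by
  simp

lemma trunc_face_two (a : Fin 3) :
    (M.trunc v).face (Sum.inr a, 2) = (Sum.inr (a + 2), 2) := by
  simp

/-- A face step of the old map is one or two face steps of the truncated map. -/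
lemma trunc_face_lift (x : V × Fin 3) :
    (M.trunc v).face (lift v x) = lift v (M.face x) ∨
      ∃ a, M.opp x = (v, a) ∧ (M.trunc v).face (lift v x) = (Sum.inr a, 1) ∧
        (M.trunc v).face (Sum.inr a, 1) = lift v (M.face x) := by
  by_cases h : (M.opp x).1 = v
  · right
    obtain ⟨a, ha⟩ : ∃ a, M.opp x = (v, a) := ⟨(M.opp x).2, Prod.ext h rfl⟩
    refine ⟨a, ha, ?_, ?_⟩
    · simp [truncOpp_lift, ha]
    · simp [ha]
  · left
    have h1 : lift v (M.opp x) = (Sum.inl ⟨_, h⟩, (M.opp x).2) := lift_of_ne v _ h _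
    simp [truncOpp_lift, h1, lift_of_ne v _ h]

lemma trunc_sameCycle_lift {x y : V × Fin 3} (h : M.face.SameCycle x y) :
    (M.trunc v).face.SameCycle (lift v x) (lift v y) := by
  have h1 : ∀ x, (M.trunc v).face.SameCycle (lift v x) (lift v (M.face x)) := by
    intro x
    rcases M.trunc_face_lift v x with h | ⟨a, -, h, h'⟩
    · exact ⟨1, by simpa using h⟩
    · refine ⟨2, ?_⟩
      rw [show (2 : ℤ) = 1 + 1 from rfl, zpow_add, zpow_one, Equiv.Perm.mul_apply, h, h']
  have h2 : ∀ (n : ℕ) x, (M.trunc v).face.SameCycle (lift v x) (lift v ((M.face ^ n) x)) := by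
    intro n
    induction n with
    | zero => intro x; exact Equiv.Perm.SameCycle.refl _ _
    | succ n ih =>
      intro x
      rw [pow_succ', Equiv.Perm.mul_apply]
      exact (ih x).trans (h1 _)
  obtain ⟨n, rfl⟩ := h
  rcases n.eq_nat_or_neg with ⟨m, rfl | rfl⟩
  · simpa using h2 m x
  · have := h2 m ((M.face ^ (-(m : ℤ))) x)
    rw [← Equiv.Perm.mul_apply, zpow_neg, zpow_natCast, mul_inv_cancel, Equiv.Perm.one_apply]
      at this
    simpa using this.symm

lemma trunc_numFaces [Finite V] : (M.trunc v).numFaces = M.numFaces + 1 := by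
  rw [numFaces, card_quotient_sameCycle (M.trunc v).face (M.truncLabel v)
    (fun l => l.elim (Sum.inr 0, 2) fun q => lift v q.out)]
  · rw [numFaces, ← Finite.card_option]
  · have hl : ∀ x, M.truncLabel v ((M.trunc v).face (lift v x)) = some ⟦x⟧ := by
      intro x
      rcases M.trunc_face_lift v x with h | ⟨a, h0, h, -⟩
      · rw [h, truncLabel_lift, mk_face]
      · rw [h, ← mk_face M x]
        simp [truncLabel, h0]
    rintro ⟨u | a, j⟩
    · rw [← lift_of_ne v u.1 u.2 j, hl, truncLabel_lift]
    · fin_cases j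
      · change M.truncLabel v ((M.trunc v).face (Sum.inr a, 0)) = M.truncLabel v (Sum.inr a, 0)
        rw [← lift_self v a, hl, truncLabel_lift]
      · change M.truncLabel v ((M.trunc v).face (Sum.inr a, 1)) = M.truncLabel v (Sum.inr a, 1)
        rw [trunc_face_one]
        rfl
      · change M.truncLabel v ((M.trunc v).face (Sum.inr a, 2)) = M.truncLabel v (Sum.inr a, 2)
        rw [trunc_face_two]
        rfl
  · rintro (_ | q)
    · rfl
    · change M.truncLabel v (lift v q.out) = some q
      rw [truncLabel_lift, Quotient.out_eq]
  · have hq : ∀ x : V × Fin 3, (M.trunc v).face.SameCycle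
        (lift v (⟦x⟧ : Quotient (Equiv.Perm.SameCycle.setoid M.face)).out) (lift v x) :=
      fun x => M.trunc_sameCycle_lift v
        (Quotient.exact (Quotient.out_eq (Quotient.mk (Equiv.Perm.SameCycle.setoid M.face) x)))
    rintro ⟨u | a, j⟩
    · rw [← lift_of_ne v u.1 u.2 j, truncLabel_lift]
      exact hq _
    · fin_cases j
      · change (M.trunc v).face.SameCycle _ (Sum.inr a, 0)
        rw [← lift_self v a]
        exact hq _
      · change (M.trunc v).face.SameCycle _ (Sum.inr a, 1)
        refine (hq (v, a + 1)).trans ?_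
        rw [lift_self, ← trunc_face_one]
        exact Equiv.Perm.sameCycle_apply_left.2 (Equiv.Perm.SameCycle.refl _ _)
      · change (M.trunc v).face.SameCycle (Sum.inr 0, 2) (Sum.inr a, 2)
        have h1 : ∀ a : Fin 3, (M.trunc v).face.SameCycle (Sum.inr a, 2) (Sum.inr (a + 2), 2) :=
          fun a => ⟨1, by simp⟩
        have h2 : a = 0 ∨ a = 2 ∨ a = 1 := by revert a; decide
        rcases h2 with rfl | rfl | rfl
        · exact Equiv.Perm.SameCycle.refl _ _
        · exact h1 0
        · exact (h1 0).trans (h1 2)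

/-- The restriction of a port set to the untruncated map. -/
lemma IsEven.of_trunc {z : TruncVert v × Fin 3 → Bool} (hz : (M.trunc v).IsEven z) :
    M.IsEven (z ∘ lift v) := by
  refine ⟨fun x => ?_, fun u => ?_⟩
  · rw [Function.comp, ← truncOpp_lift]
    exact hz.1 _
  · by_cases hu : u = v
    · subst hu
      simp only [Function.comp, lift_self]
      have h1 : ∀ a, z (Sum.inr (a + 1), 2) = z (Sum.inr a, 1) :=
        fun a => hz.1 (Sum.inr a, 1)
      have a0 := hz.2 (Sum.inr 0)
      have a1 := hz.2 (Sum.inr 1)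
      have a2 := hz.2 (Sum.inr 2)
      have b0 := h1 0
      have b1 := h1 1
      have b2 := h1 2
      simp only [Fin.isValue, Fin.reduceAdd, zero_add] at b0 b1 b2
      rw [b2] at a0
      rw [b0] at a1
      rw [b1] at a2
      revert a0 a1 a2
      cases z (Sum.inr 0, 0) <;> cases z (Sum.inr 1, 0) <;> cases z (Sum.inr 2, 0) <;>
        cases z (Sum.inr 0, 1) <;> cases z (Sum.inr 1, 1) <;> cases z (Sum.inr 2, 1) <;> simp
    · simp only [Function.comp, lift_of_ne v u hu]
      exact hz.2 _

/-- The vertices at which a port set has a port. -/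
def used {V : Type} [Fintype V] (z : V × Fin 3 → Bool) : Finset V :=
  Finset.univ.filter fun v => ∃ i, z (v, i) = true

/-- Truncating a used vertex makes an even port set longer. -/
lemma card_used_trunc [DecidableEq V] [Fintype V] [Fintype (TruncVert v)]
    {z : TruncVert v × Fin 3 → Bool}
    (hz : (M.trunc v).IsEven z) :
    (used (z ∘ lift v)).card + (if v ∈ used (z ∘ lift v) then 1 else 0) ≤ (used z).card := by
  classical
  have heven := IsEven.of_trunc M v hz
  set y := z ∘ lift v with hy
  have hmap : ∀ u (hu : u ≠ v), u ∈ used y → Sum.inl ⟨u, hu⟩ ∈ used z := by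
    intro u hu h
    simpa [used, hy, lift_of_ne v u hu] using h
  have htip : ∀ i, y (v, i) = true → Sum.inr i ∈ used z := by
    intro i h
    simp only [hy, Function.comp, lift_self] at h
    simp only [used, Finset.mem_filter, Finset.mem_univ, true_and]
    exact ⟨0, h⟩
  obtain ⟨L, hL⟩ : ∃ L, L = (used z).filter fun x => x.isLeft := ⟨_, rfl⟩
  obtain ⟨R, hR⟩ : ∃ R, R = (used z).filter fun x => x.isRight := ⟨_, rfl⟩
  have h1 : (((used y).erase v).attach.map ⟨fun u => (Sum.inl ⟨u.1, Finset.ne_of_mem_erase u.2⟩ :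
      TruncVert v), fun a b h => by
        simp only [Sum.inl.injEq, Subtype.mk.injEq] at h
        exact Subtype.ext h⟩) ⊆ L := by
    intro x hx
    rw [hL]
    obtain ⟨u, -, rfl⟩ := Finset.mem_map.1 hx
    exact Finset.mem_filter.2 ⟨hmap u.1 _ (Finset.mem_of_mem_erase u.2), rfl⟩
  have h1' := Finset.card_le_card h1
  rw [Finset.card_map, Finset.card_attach] at h1'
  have h3 : L.card + R.card = (used z).card := by
    rw [hL, hR, ← Finset.card_union_of_disjoint, ← Finset.filter_or]
    · congr 1
      refine Finset.filter_true_of_mem ?_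
      rintro (x | x) - <;> simp
    · refine Finset.disjoint_filter.2 ?_
      rintro (x | x) - <;> simp
  by_cases hv : v ∈ used y
  · have h2 : 2 ≤ R.card := by
      rw [hR]
      obtain ⟨i, j, hij, hi, hj⟩ : ∃ i j, i ≠ j ∧ y (v, i) = true ∧ y (v, j) = true := by
        have h4 := heven.2 v
        simp only [used, Finset.mem_filter, Finset.mem_univ, true_and, Fin.exists_fin_succ,
          IsEmpty.exists_iff, or_false] at hv
        have : (y (v, 0) = true ∧ y (v, 1) = true) ∨ (y (v, 1) = true ∧ y (v, 2) = true) ∨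
            (y (v, 0) = true ∧ y (v, 2) = true) := by
          revert h4 hv
          simp only [Fin.isValue, Fin.succ_zero_eq_one, Fin.succ_one_eq_two]
          cases y (v, 0) <;> cases y (v, 1) <;> cases y (v, 2) <;> simp
        rcases this with h | h | h
        · exact ⟨0, 1, by decide, h.1, h.2⟩
        · exact ⟨1, 2, by decide, h.1, h.2⟩
        · exact ⟨0, 2, by decide, h.1, h.2⟩
      calc 2 = ({Sum.inr i, Sum.inr j} : Finset (TruncVert v)).card := by
            rw [Finset.card_pair (by simpa using hij)]
        _ ≤ _ := Finset.card_le_card (by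
            intro x hx
            simp only [Finset.mem_insert, Finset.mem_singleton] at hx
            rcases hx with rfl | rfl <;> simp [htip _ hi, htip _ hj])
    rw [Finset.card_erase_of_mem hv] at h1'
    simp only [hv, if_true]
    omega
  · rw [Finset.erase_eq_of_notMem hv] at h1'
    simp only [hv, if_false]
    omega

end Truncation

section Graph

variable {V : Type} (M : CubicMap V)

/-- The underlying graph of a cubic map. -/
def graph : SimpleGraph V where
  Adj u v := ∃ i, (M.opp (u, i)).1 = v
  symm := ⟨by
    rintro u v ⟨i, rfl⟩
    exact ⟨(M.opp (u, i)).2, by rw [Prod.mk.eta, M.opp_opp]⟩⟩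
  loopless := ⟨by
    rintro u ⟨i, h⟩
    exact M.opp_ne u i h⟩

lemma adj_opp (x : V × Fin 3) : M.graph.Adj x.1 (M.opp x).1 := ⟨x.2, rfl⟩

lemma neighborSet_eq (v : V) :
    M.graph.neighborSet v = Set.range fun i => (M.opp (v, i)).1 := by
  ext u; rfl

lemma isCubic : IsCubic M.graph := by
  intro v
  rw [neighborSet_eq, Set.ncard_range_of_injective fun i j h => M.opp_inj v i j h]
  simp

lemma exists_ne_of_card (h3 : 3 < Nat.card V) (u v : V) :
    ∃ a, a ≠ u ∧ a ≠ v := by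
  by_contra! h
  have h1 : (Set.univ : Set V) ⊆ {u, v} := fun a _ => by
    by_cases ha : a = u
    · simp [ha]
    · simp [h a ha]
  have h2 := Set.ncard_le_ncard h1 (by simp)
  have h4 := Set.ncard_insert_le u ({v} : Set V)
  rw [Set.ncard_univ] at h2
  simp at h4
  omega

lemma isThreeConnected (hM : M.Conn) (h3 : 3 < Nat.card V) : IsThreeConnected M.graph := by
  refine ⟨by rwa [Set.ncard_univ], fun s hs hcard => ?_⟩
  have hV : Finite V := Nat.finite_of_card_ne_zero (by omega)
  have key : ∀ f : V → Prop, (∀ u v, u ∉ s → v ∉ s → M.graph.Adj u v → (f u ↔ f v)) →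
      ∀ u v, u ∉ s → v ∉ s → (f u ↔ f v) := by
    intro f hf u v hu hv
    obtain ⟨a, b, hsub, hua, hub, hva, hvb⟩ : ∃ a b, s ⊆ {a, b} ∧ u ≠ a ∧ u ≠ b ∧ v ≠ a ∧
        v ≠ b := by
      rcases Nat.lt_or_ge s.ncard 2 with h | h
      · obtain ⟨c, hcu, hcv⟩ := exists_ne_of_card h3 u v
        have : Nonempty V := ⟨u⟩
        obtain ⟨a, ha⟩ := (Set.ncard_le_one_iff_subset_singleton (s := s) hs).1
          (Nat.lt_succ_iff.1 h)
        by_cases has : a ∈ s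
        · exact ⟨a, a, by simpa using ha, fun h => hu (h ▸ has), fun h => hu (h ▸ has),
            fun h => hv (h ▸ has), fun h => hv (h ▸ has)⟩
        · have hs0 : s = ∅ := by
            ext x
            simp only [Set.mem_empty_iff_false, iff_false]
            intro hx
            exact has (ha hx ▸ hx)
          exact ⟨c, c, by simp [hs0], hcu.symm, hcu.symm, hcv.symm, hcv.symm⟩
      · obtain ⟨a, b, -, rfl⟩ := Set.ncard_eq_two.1 (le_antisymm (Nat.lt_succ_iff.1 hcard) h)
        simp only [Set.mem_insert_iff, Set.mem_singleton_iff, not_or] at hu hv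
        exact ⟨a, b, subset_rfl, hu.1, hu.2, hv.1, hv.2⟩
    refine hM a b f ?_ u v hua hub hva hvb
    intro x i h1 h2 h4 h5
    refine hf _ _ (fun h => ?_) (fun h => ?_) (M.adj_opp (x, i))
    · rcases hsub h with h | h
      · exact h1 h
      · exact h2 h
    · rcases hsub h with h | h
      · exact h4 h
      · exact h5 h
  have hne : ∃ u, u ∉ s := by
    by_contra! h
    have : s = Set.univ := Set.eq_univ_of_forall h
    rw [this, Set.ncard_univ] at hcard
    omega
  obtain ⟨u, hu⟩ := hne
  rw [SimpleGraph.connected_iff_exists_forall_reachable]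
  refine ⟨⟨u, hu⟩, ?_⟩
  rintro ⟨v, hv⟩
  have := key (fun x => ∃ h : x ∉ s, (M.graph.induce (sᶜ : Set V)).Reachable ⟨u, hu⟩ ⟨x, h⟩)
    ?_ u v hu hv
  · exact (this.1 ⟨hu, SimpleGraph.Reachable.refl _⟩).2
  · intro x y hx hy hxy
    have hadj : (M.graph.induce (sᶜ : Set V)).Adj ⟨x, hx⟩ ⟨y, hy⟩ := hxy
    exact ⟨fun ⟨_, h⟩ => ⟨hy, h.trans hadj.reachable⟩,
      fun ⟨_, h⟩ => ⟨hx, h.trans hadj.symm.reachable⟩⟩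

lemma connected (hM : M.Conn) (h3 : 3 < Nat.card V) : M.graph.Connected := by
  have h := (M.isThreeConnected hM h3).2 ∅ (by simp) (by simp)
  refine (SimpleGraph.Iso.connected_iff (SimpleGraph.Iso.symm ?_)).1 h
  exact ⟨(Equiv.Set.univ V).symm.trans (Equiv.setCongr (by simp)), Iff.rfl⟩

/-- Ports are the same thing as darts. -/
noncomputable def dartEquiv : V × Fin 3 ≃ M.graph.Dart :=
  Equiv.ofBijective (fun x => ⟨(x.1, (M.opp x).1), M.adj_opp x⟩) <| by
    constructor
    · rintro ⟨u, i⟩ ⟨v, j⟩ h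
      simp only [SimpleGraph.Dart.mk.injEq, Prod.mk.injEq] at h
      obtain ⟨rfl, h⟩ := h
      rw [M.opp_inj u i j h]
    · rintro ⟨⟨u, v⟩, i, h⟩
      exact ⟨(u, i), by simpa [SimpleGraph.Dart.ext_iff] using h⟩

@[simp] lemma dartEquiv_fst (x : V × Fin 3) : (M.dartEquiv x).toProd.1 = x.1 := rfl

@[simp] lemma dartEquiv_snd (x : V × Fin 3) : (M.dartEquiv x).toProd.2 = (M.opp x).1 := rfl

lemma dartEquiv_opp (x : V × Fin 3) : M.dartEquiv (M.opp x) = (M.dartEquiv x).symm := by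
  ext <;> simp [M.opp_opp]

/-- The rotation of the ports. -/
def rotation (V : Type) : Equiv.Perm (V × Fin 3) where
  toFun x := (x.1, x.2 + 1)
  invFun x := (x.1, x.2 + 2)
  left_inv x := by simp [add_assoc]
  right_inv x := by simp [add_assoc]

lemma rotation_pow (n : ℕ) (x : V × Fin 3) :
    (rotation V ^ n) x = (x.1, x.2 + Fin.ofNat 3 n) := by
  induction n with
  | zero => simp
  | succ n ih =>
    rw [pow_succ', Equiv.Perm.mul_apply, ih]
    ext
    · rfl
    · simp [rotation, Fin.val_add]; omega

/-- The rotation system of a cubic map. -/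
noncomputable def embedding : PlaneEmbedding M.graph where
  rot := M.dartEquiv.permCongr (rotation V)
  rot_tail d := by
    obtain ⟨x, rfl⟩ := M.dartEquiv.surjective d
    simp [Equiv.permCongr_apply, rotation]
  rot_orbit d e h := by
    obtain ⟨x, rfl⟩ := M.dartEquiv.surjective d
    obtain ⟨y, rfl⟩ := M.dartEquiv.surjective e
    have hpow : ∀ n : ℕ, (M.dartEquiv.permCongr (rotation V) ^ n) (M.dartEquiv x) =
        M.dartEquiv ((rotation V ^ n) x) := by
      intro n
      induction n with
      | zero => simp
      | succ n ih =>
        rw [pow_succ', Equiv.Perm.mul_apply, ih, pow_succ', Equiv.Perm.mul_apply]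
        simp [Equiv.permCongr_apply]
    refine ⟨(y.2 - x.2).val, ?_⟩
    rw [hpow, rotation_pow]
    congr 1
    ext1
    · exact h
    · simp

lemma embedding_facePerm (x : V × Fin 3) :
    M.embedding.facePerm (M.dartEquiv x) = M.dartEquiv (M.face x) := by
  simp [PlaneEmbedding.facePerm, embedding, dartReversal, ← dartEquiv_opp,
    Equiv.permCongr_apply, rotation]

lemma embedding_facePerm_zpow (n : ℤ) (x : V × Fin 3) :
    (M.embedding.facePerm ^ n) (M.dartEquiv x) = M.dartEquiv ((M.face ^ n) x) := by
  have : M.embedding.facePerm = M.dartEquiv.permCongrHom M.face := by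
    ext1 d
    obtain ⟨x, rfl⟩ := M.dartEquiv.surjective d
    rw [embedding_facePerm]
    simp [Equiv.permCongrHom, Equiv.permCongr_apply]
  rw [this, ← map_zpow]
  simp [Equiv.permCongrHom, Equiv.permCongr_apply]

lemma ncard_faces : M.embedding.faces.ncard = M.numFaces := by
  have hface : ∀ x y, M.embedding.faceOf (M.dartEquiv x) = M.embedding.faceOf (M.dartEquiv y) ↔
      M.face.SameCycle x y := by
    have hmem : ∀ x y, M.dartEquiv y ∈ M.embedding.faceOf (M.dartEquiv x) ↔
        M.face.SameCycle x y := by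
      intro x y
      simp only [PlaneEmbedding.faceOf, Set.mem_ofPred_eq, embedding_facePerm_zpow,
        M.dartEquiv.injective.eq_iff]
      rfl
    intro x y
    constructor
    · intro h
      rw [← hmem, h, hmem]
    · intro h
      ext d
      obtain ⟨w, rfl⟩ := M.dartEquiv.surjective d
      rw [hmem, hmem]
      exact ⟨fun h' => h.symm.trans h', fun h' => h.trans h'⟩
  let g : Quotient (Equiv.Perm.SameCycle.setoid M.face) → Set M.graph.Dart :=
    Quotient.lift (fun x => M.embedding.faceOf (M.dartEquiv x)) fun x y h => (hface x y).2 h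
  have hg : Function.Injective g := by
    intro p q
    induction p using Quotient.inductionOn
    induction q using Quotient.inductionOn
    intro h
    exact Quotient.sound ((hface _ _).1 h)
  have hr : M.embedding.faces = Set.range g := by
    ext s
    constructor
    · rintro ⟨d, rfl⟩
      obtain ⟨x, rfl⟩ := M.dartEquiv.surjective d
      exact ⟨⟦x⟧, rfl⟩
    · rintro ⟨q, rfl⟩
      induction q using Quotient.inductionOn with
      | _ x => exact ⟨M.dartEquiv x, rfl⟩
  rw [hr, Set.ncard_range_of_injective hg, numFaces]

lemma two_mul_ncard_edgeSet [Finite V] : 2 * M.graph.edgeSet.ncard = 3 * Nat.card V := by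
  classical
  have := Fintype.ofFinite V
  have h := M.graph.dart_card_eq_twice_card_edges
  rw [← Fintype.card_congr M.dartEquiv] at h
  rw [← SimpleGraph.coe_edgeFinset, Set.ncard_coe_finset, ← h]
  simp [mul_comm]

lemma isPlanar [Finite V] (hM : M.Conn) (h3 : 3 < Nat.card V)
    (he : 2 * M.numFaces = Nat.card V + 4) : IsPlanar M.graph := by
  refine ⟨M.connected hM h3, M.embedding, ?_⟩
  have := M.two_mul_ncard_edgeSet
  rw [PlaneEmbedding.IsSpherical, ncard_faces, Set.ncard_univ]
  omega

/-- The ports on the edges of a cycle form an even set. -/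
lemma exists_isEven {v : V} (w : M.graph.Walk v v) (hw : w.IsCycle) :
    ∃ z : V × Fin 3 → Bool, M.IsEven z ∧
      (∀ x, z x = true ↔ s(x.1, (M.opp x).1) ∈ w.edges) := by
  classical
  refine ⟨fun x => decide (s(x.1, (M.opp x).1) ∈ w.edges), ⟨fun x => ?_, fun u => ?_⟩, by simp⟩
  · simp only [M.opp_opp]
    rw [Sym2.eq_swap]
  · set z : Fin 3 → Bool := fun i => decide (s(u, (M.opp (u, i)).1) ∈ w.edges) with hz
    change ((z 0 ^^ z 1) ^^ z 2) = false
    by_cases hu : u ∈ w.support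
    · have h2 := hw.ncard_neighborSet_toSubgraph_eq_two hu
      have hset : w.toSubgraph.neighborSet u =
          (fun i => (M.opp (u, i)).1) '' {i | z i = true} := by
        ext x
        simp only [SimpleGraph.Subgraph.mem_neighborSet, Set.mem_image, Set.mem_ofPred_eq, hz,
          decide_eq_true_eq, ← SimpleGraph.Walk.mem_edges_toSubgraph,
          SimpleGraph.Subgraph.mem_edgeSet]
        constructor
        · intro h
          obtain ⟨i, hi⟩ := h.adj_sub
          exact ⟨i, by rwa [hi], hi⟩
        · rintro ⟨i, h, rfl⟩
          exact h
      rw [hset, Set.ncard_image_of_injective _ fun i j h => M.opp_inj u i j h] at h2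
      have h4 : ∀ z : Fin 3 → Bool, (Finset.univ.filter fun i => z i = true).card = 2 →
          ((z 0 ^^ z 1) ^^ z 2) = false := by decide
      apply h4
      rw [← h2, Set.ncard_eq_toFinset_card']
      simp
    · have : ∀ i, z i = false := by
        intro i
        simp only [hz, decide_eq_false_iff_not]
        exact fun h => hu (w.fst_mem_support_of_mem_edges h)
      simp [this]

lemma card_used_le_length [Fintype V] {v : V} (w : M.graph.Walk v v)
    {z : V × Fin 3 → Bool} (hz : ∀ x, z x = true ↔ s(x.1, (M.opp x).1) ∈ w.edges) :
    (used z).card ≤ w.length := by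
  classical
  calc (used z).card ≤ w.support.tail.toFinset.card := by
        refine Finset.card_le_card fun u hu => ?_
        simp only [used, Finset.mem_filter, Finset.mem_univ, true_and, hz] at hu
        obtain ⟨i, hi⟩ := hu
        have h1 := w.fst_mem_support_of_mem_edges hi
        have h2 := w.snd_mem_support_of_mem_edges hi
        rw [List.mem_toFinset]
        rw [SimpleGraph.Walk.mem_support_iff] at h1
        rcases h1 with rfl | h1
        · refine SimpleGraph.Walk.end_mem_tail_support ?_
          cases w with
          | nil => simp at hi
          | cons h p => simp
        · exact h1
    _ ≤ w.support.tail.length := List.toFinset_card_le _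
    _ = w.length := by simp

end Graph

variable {A : Type} [DecidableEq A] [Fintype A]

/-- A planar cubic map obtained from `H` by replacing vertices by fragments. The ports of `H` survive
as the ports `tip x`, and `proj` maps the vertices of each fragment to the vertex it replaces. The
fragment at `a` has at most `size a` vertices, every even port set is at least as long as half of the
total weight `W` of its tips, and the vertices outside of `T` are still intact. -/
structure Realization (H : CubicMap A) (W : A × Fin 3 → ℕ) (size : A → ℕ) (T : Set A) where
  V : Type
  fintype : Fintype V
  M : CubicMap V
  conn : M.Conn
  euler : 2 * M.numFaces = Fintype.card V + 4
  tip : A × Fin 3 → V × Fin 3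
  tip_injective : Function.Injective tip
  opp_tip : ∀ x, M.opp (tip x) = tip (H.opp x)
  proj : V → A
  proj_tip : ∀ x, proj (tip x).1 = x.1
  proj_opp : ∀ y, y ∉ Set.range tip → proj (M.opp y).1 = proj y.1
  sum_fiber_le : ∀ a, (∑ v, if proj v = a then 1 else 0) ≤ size a
  even_tip : ∀ z, M.IsEven z → H.IsEven (z ∘ tip)
  sum_le : ∀ z, M.IsEven z → (∑ x, if z (tip x) then W x else 0) ≤ 2 * (used z).card
  tip_fst_eq : ∀ a ∉ T, ∀ i, (tip (a, i)).1 = (tip (a, 0)).1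
  eq_or_of_tip_fst_eq : ∀ x y, (tip x).1 = (tip y).1 → x = y ∨ (x.1 = y.1 ∧ x.1 ∉ T)

attribute [instance] Realization.fintype

namespace Realization

variable {H : CubicMap A} {W W' : A × Fin 3 → ℕ} {size size' : A → ℕ} {T : Set A}

lemma count_ports_le {y : Fin 3 → Bool} (h : ((y 0 ^^ y 1) ^^ y 2) = false) :
    (∑ i, if y i then 1 else 0) ≤ if ∃ i, y i = true then 2 else 0 := by
  revert y
  decide

/-- The map `H` itself, with no vertex replaced. -/
def base (H : CubicMap A) (hH : H.Conn) (he : 2 * H.numFaces = Fintype.card A + 4) :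
    Realization H (fun _ => 1) (fun _ => 1) ∅ where
  V := A
  fintype := inferInstance
  M := H
  conn := hH
  euler := he
  tip := id
  tip_injective := Function.injective_id
  opp_tip _ := rfl
  proj := id
  proj_tip _ := rfl
  proj_opp y h := absurd ⟨y, rfl⟩ h
  sum_fiber_le a := by simp
  even_tip _ hz := hz
  sum_le z hz := by
    rw [Fintype.sum_prod_type]
    calc (∑ v, ∑ i, if z (id (v, i)) then 1 else 0)
        ≤ ∑ v, if ∃ i, z (v, i) = true then 2 else 0 :=
          Finset.sum_le_sum fun v _ => count_ports_le (y := fun i => z (v, i)) (hz.2 v)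
      _ = 2 * (used z).card := by
          rw [used, Finset.card_filter, Finset.mul_sum]
          simp
  tip_fst_eq _ _ _ := rfl
  eq_or_of_tip_fst_eq _ _ h := Or.inr ⟨h, by simp⟩

/-- Truncating the vertex that carries the tip `x₀`. -/
noncomputable def trunc (R : Realization H W size T) (x₀ : A × Fin 3) (c : ℕ)
    (P : A × Fin 3 → Prop) [DecidablePred P] (hP : ∀ x, (R.tip x).1 = (R.tip x₀).1 ↔ P x)
    (hc : ∀ z, H.IsEven z → c * (∑ x, if P x ∧ z x = true then 1 else 0) ≤ 2)
    (hW : ∀ x, W' x ≤ W x + if P x then c else 0)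
    (hsize : ∀ a, size a + (if a = x₀.1 then 2 else 0) ≤ size' a) :
    Realization H W' size' (insert x₀.1 T) := by
  classical
  set v := (R.tip x₀).1 with hv
  set p : TruncVert v → A := Sum.elim (fun u => R.proj u.1) (fun _ => R.proj v) with hp
  have hlift : ∀ y, p (lift v y).1 = R.proj y.1 := by
    rintro ⟨u, i⟩
    by_cases hu : u = v
    · subst hu; simp [hp]
    · simp [lift_of_ne v u hu, hp]
  refine
  { V := TruncVert v
    fintype := inferInstance
    M := R.M.trunc v
    conn := R.M.trunc_conn v R.conn
    euler := ?_
    tip := fun x => lift v (R.tip x)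
    tip_injective := (lift_injective v).comp R.tip_injective
    opp_tip := fun x => by rw [trunc_opp, truncOpp_lift, R.opp_tip]
    proj := p
    proj_tip := fun x => by rw [hlift, R.proj_tip]
    proj_opp := ?_
    sum_fiber_le := ?_
    even_tip := fun z hz => R.even_tip _ (hz.of_trunc R.M v)
    sum_le := ?_
    tip_fst_eq := ?_
    eq_or_of_tip_fst_eq := ?_ }
  · have := R.euler
    have h := Fintype.sum_eq_add_sum_subtype_ne (fun _ : R.V => 1) v
    simp only [Finset.sum_const, Finset.card_univ, smul_eq_mul, mul_one] at h
    rw [trunc_numFaces, Fintype.card_sum, Fintype.card_fin]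
    omega
  · have hmem : ∀ y, lift v y ∉ Set.range (fun x => lift v (R.tip x)) → y ∉ Set.range R.tip := by
      rintro y h ⟨x, rfl⟩
      exact h ⟨x, rfl⟩
    have hl : ∀ y, lift v y ∉ Set.range (fun x => lift v (R.tip x)) →
        p ((R.M.trunc v).opp (lift v y)).1 = p (lift v y).1 := by
      intro y h
      rw [trunc_opp, truncOpp_lift, hlift, hlift, R.proj_opp y (hmem y h)]
    rintro ⟨u | a, j⟩ h
    · rw [← lift_of_ne v u.1 u.2 j] at h ⊢
      exact hl _ h
    · fin_cases j
      · exact lift_self v a ▸ hl (v, a) (by rwa [lift_self])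
      · rfl
      · rfl
  · intro a
    have h1 := R.sum_fiber_le a
    rw [Fintype.sum_eq_add_sum_subtype_ne _ v] at h1
    rw [Fintype.sum_sum_type]
    have h2 := hsize a
    simp only [hp, Sum.elim_inl, Sum.elim_inr, Finset.sum_const, Finset.card_univ,
      Fintype.card_fin, smul_eq_mul]
    have h3 : R.proj v = a ↔ a = x₀.1 := by rw [hv, R.proj_tip]; exact eq_comm
    simp only [h3] at h1 ⊢
    split_ifs at h1 h2 ⊢ <;> omega
  · intro z hz
    have h1 := R.M.card_used_trunc v hz
    have h2 := R.sum_le _ (hz.of_trunc R.M v)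
    have h3 := hc _ (R.even_tip _ (hz.of_trunc R.M v))
    set y := z ∘ lift v with hy
    have h4 : (∑ x, if z (lift v (R.tip x)) then W' x else 0) ≤
        (∑ x, if y (R.tip x) then W x else 0) +
          c * ∑ x, if P x ∧ (y ∘ R.tip) x = true then 1 else 0 := by
      rw [Finset.mul_sum, ← Finset.sum_add_distrib]
      refine Finset.sum_le_sum fun x _ => ?_
      have := hW x
      simp only [hy, Function.comp]
      by_cases h6 : z (lift v (R.tip x)) = true
      · by_cases h5 : P x <;> simpa [h5, h6] using this
      · simp [h6]
    have h5 : c * (∑ x, if P x ∧ (y ∘ R.tip) x = true then 1 else 0) ≤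
        2 * if v ∈ used y then 1 else 0 := by
      by_cases h6 : v ∈ used y
      · simpa [h6] using h3
      · have : ∀ x, ¬ (P x ∧ (y ∘ R.tip) x = true) := by
          rintro x ⟨h7, h8⟩
          refine h6 ?_
          rw [← hP] at h7
          simp only [used, Finset.mem_filter, Finset.mem_univ, true_and]
          exact ⟨(R.tip x).2, by rw [← h7]; exact h8⟩
        simp only [this, if_false, Finset.sum_const_zero, mul_zero, zero_le]
    omega
  · intro a ha i
    have hne : ∀ i, (R.tip (a, i)).1 ≠ v := by
      intro i h
      rcases R.eq_or_of_tip_fst_eq _ _ h with h | h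
      · exact ha (Or.inl (by rw [← h]))
      · exact ha (Or.inl h.1)
    have hl : ∀ i, (lift v (R.tip (a, i))).1 = Sum.inl ⟨_, hne i⟩ := fun i => by
      rw [lift_fst_eq_inl_iff]
    rw [hl, hl]
    simp only [R.tip_fst_eq a (fun h => ha (Or.inr h)) i]
  · intro x y h
    have h1 := fst_eq_of_lift_fst_eq v h
    by_cases hx : (R.tip x).1 = v
    · left
      have h2 : R.tip x = (v, (R.tip x).2) := Prod.ext hx rfl
      have h3 : R.tip y = (v, (R.tip y).2) := Prod.ext (h1 ▸ hx) rfl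
      rw [h2, h3, lift_self, lift_self] at h
      simp only [Sum.inr.injEq] at h
      rw [← h, ← h2] at h3
      exact (R.tip_injective h3).symm
    · rcases R.eq_or_of_tip_fst_eq _ _ h1 with h2 | ⟨h2, h3⟩
      · exact Or.inl h2
      · refine Or.inr ⟨h2, ?_⟩
        rintro (h4 | h4)
        · refine hx ?_
          have := R.tip_fst_eq x.1 h3
          rw [show R.tip x = R.tip (x.1, x.2) from rfl, this, hv,
            show R.tip x₀ = R.tip (x₀.1, x₀.2) from rfl, ← h4, this x₀.2]
        · exact h3 h4

/-- Replacing an intact vertex by a triangle. -/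
noncomputable def truncVertex (R : Realization H W size T) (a : A) (ha : a ∉ T) :
    Realization H (fun x => W x + if x.1 = a then 1 else 0)
      (fun b => size b + if b = a then 2 else 0) (insert a T) := by
  have htip : ∀ x, (R.tip x).1 = (R.tip (a, 0)).1 ↔ x.1 = a := by
    intro x
    constructor
    · intro h
      rcases R.eq_or_of_tip_fst_eq _ _ h with h | h
      · rw [h]
      · exact h.1
    · rintro rfl
      exact R.tip_fst_eq _ ha _
  refine R.trunc (a, 0) 1 _ htip (fun z hz => ?_) (fun x => ?_) (fun b => le_rfl)
  · have h1 := count_ports_le (y := fun i => z (a, i)) (hz.2 a)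
    rw [one_mul]
    rw [Fintype.sum_prod_type, Finset.sum_eq_single a (by simp +contextual) (by simp)]
    simp only [true_and]
    refine h1.trans ?_
    split_ifs <;> simp
  · rfl

/-- Replacing the tip vertex of a truncated vertex by a triangle. -/
noncomputable def truncTip (R : Realization H W size Set.univ) (x₀ : A × Fin 3) :
    Realization H (fun x => W x + if x = x₀ then 2 else 0)
      (fun b => size b + if b = x₀.1 then 2 else 0) Set.univ := by
  have htip : ∀ x, (R.tip x).1 = (R.tip x₀).1 ↔ x = x₀ := by
    intro x
    constructor
    · intro h
      simpa using R.eq_or_of_tip_fst_eq _ _ h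
    · rintro rfl
      rfl
  rw [← Set.insert_eq_of_mem (Set.mem_univ x₀.1)]
  refine R.trunc x₀ 2 _ htip (fun z _ => ?_) (fun x => ?_) (fun b => le_rfl)
  · rw [Finset.sum_eq_single x₀ (by simp +contextual) (by simp)]
    split_ifs <;> simp
  · rfl

lemma nonempty_finset (hH : H.Conn) (he : 2 * H.numFaces = Fintype.card A + 4) (s : Finset A) :
    Nonempty (Realization H (fun x => if x.1 ∈ s then 2 else 1)
      (fun a => if a ∈ s then 3 else 1) s) := by
  induction s using Finset.induction_on with
  | empty => exact ⟨by simpa using base H hH he⟩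
  | insert a s ha ih =>
    obtain ⟨R⟩ := ih
    have := R.truncVertex a (by simpa using ha)
    refine ⟨?_⟩
    convert this using 1
    · ext x
      by_cases h : x.1 = a <;> simp [h, ha]
    · ext b
      by_cases h : b = a <;> simp [h, ha]
    · simp

lemma nonempty_multiset (hH : H.Conn) (he : 2 * H.numFaces = Fintype.card A + 4)
    (m : Multiset (A × Fin 3)) :
    Nonempty (Realization H (fun x => 2 + 2 * m.count x)
      (fun a => 3 + 2 * ∑ i, m.count (a, i)) Set.univ) := by
  induction m using Multiset.induction_on with
  | empty =>
    obtain ⟨R⟩ := nonempty_finset hH he Finset.univ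
    exact ⟨by simpa using R⟩
  | cons x₀ m ih =>
    obtain ⟨R⟩ := ih
    refine ⟨?_⟩
    convert R.truncTip x₀ using 1
    · ext x
      rw [Multiset.count_cons]
      split_ifs <;> omega
    · ext a
      simp only [Multiset.count_cons, Finset.sum_add_distrib]
      by_cases h : a = x₀.1
      · subst h
        simp [Prod.ext_iff]
        omega
      · simp [Prod.ext_iff, h]

/-- Every choice of tip fragments can be realized. -/
lemma nonempty (hH : H.Conn) (he : 2 * H.numFaces = Fintype.card A + 4) (n : A × Fin 3 → ℕ) :
    Nonempty (Realization H (fun x => 2 + 2 * n x) (fun a => 3 + 2 * ∑ i, n (a, i)) Set.univ) := by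
  obtain ⟨R⟩ := nonempty_multiset hH he (∑ x, n x • ({x} : Multiset (A × Fin 3)))
  refine ⟨?_⟩
  simpa [Multiset.count_sum', Multiset.count_singleton] using R

end Realization

section Transport

variable {V V' : Type} (M : CubicMap V)

/-- Renaming the vertices. -/
def congr (e : V ≃ V') : CubicMap V' where
  opp x := (e (M.opp (e.symm x.1, x.2)).1, (M.opp (e.symm x.1, x.2)).2)
  opp_opp x := by simp [M.opp_opp]
  opp_ne v i h := M.opp_ne (e.symm v) i (by simpa using congrArg e.symm h)
  opp_inj v i j h := M.opp_inj (e.symm v) i j (e.injective h)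

lemma congr_opp (e : V ≃ V') (x : V' × Fin 3) :
    (M.congr e).opp x = (e (M.opp (e.symm x.1, x.2)).1, (M.opp (e.symm x.1, x.2)).2) := rfl

lemma congr_conn (e : V ≃ V') (hM : M.Conn) : (M.congr e).Conn := by
  intro a b f hf u v h1 h2 h3 h4
  have := hM (e.symm a) (e.symm b) (f ∘ e) ?_ (e.symm u) (e.symm v) (by simpa) (by simpa)
    (by simpa) (by simpa)
  · simpa using this
  · intro v i h1 h2 h3 h4
    have := hf (e v) i (fun h => h1 (by simp [← h])) (fun h => h2 (by simp [← h]))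
    simp only [congr_opp, e.symm_apply_apply] at this
    exact this (fun h => h3 (by simp [← h])) (fun h => h4 (by simp [← h]))

lemma congr_numFaces (e : V ≃ V') : (M.congr e).numFaces = M.numFaces := by
  have hf : ∀ x : V × Fin 3, (M.congr e).face (e x.1, x.2) = (e (M.face x).1, (M.face x).2) := by
    intro x
    simp [congr_opp]
  have hpow : ∀ (n : ℕ) (x : V × Fin 3), ((M.congr e).face ^ n) (e x.1, x.2) =
      (e ((M.face ^ n) x).1, ((M.face ^ n) x).2) := by
    intro n
    induction n with
    | zero => simp
    | succ n ih => intro x; rw [pow_succ', Equiv.Perm.mul_apply, ih, pow_succ',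
        Equiv.Perm.mul_apply, hf]
  rw [numFaces, card_quotient_sameCycle (M.congr e).face
    (fun x => (⟦(e.symm x.1, x.2)⟧ : Quotient (Equiv.Perm.SameCycle.setoid M.face)))
    (fun q => (e q.out.1, q.out.2)), numFaces]
  · intro x
    have := hf (e.symm x.1, x.2)
    simp only [e.apply_symm_apply] at this
    rw [this]
    simp only [e.symm_apply_apply]
    exact M.mk_face _
  · intro q
    simp
  · intro x
    obtain ⟨n, hn⟩ := (Quotient.exact (Quotient.out_eq
      (Quotient.mk (Equiv.Perm.SameCycle.setoid M.face) (e.symm x.1, x.2))) :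
        M.face.SameCycle _ _)
    have key : ∀ (n : ℕ) (x y : V × Fin 3), (M.face ^ n) x = y →
        (M.congr e).face.SameCycle (e x.1, x.2) (e y.1, y.2) := by
      rintro n x y rfl
      exact ⟨n, by rw [zpow_natCast, hpow]⟩
    rcases n.eq_nat_or_neg with ⟨m, rfl | rfl⟩
    · convert key m _ _ (by simpa using hn) using 1
      simp
    · rw [zpow_neg, Equiv.Perm.inv_eq_iff_eq, zpow_natCast] at hn
      convert (key m _ _ hn.symm).symm using 1
      simp

/-- Renaming the vertices is an isomorphism of the underlying graphs. -/
def congrIso (e : V ≃ V') : M.graph ≃g (M.congr e).graph where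
  toEquiv := e
  map_rel_iff' := by
    intro u v
    simp [graph, congr_opp]

lemma cycleLengths_subset_of_iso {G : SimpleGraph V} {G' : SimpleGraph V'} (f : G ≃g G') :
    CycleLengths G ⊆ CycleLengths G' := by
  rintro n ⟨v, w, hw, rfl⟩
  exact ⟨f v, w.map f.toHom, hw.map f.injective, by simp⟩

lemma exists_fin [Fintype V] (hM : M.Conn) (h3 : 3 < Nat.card V)
    (he : 2 * M.numFaces = Fintype.card V + 4) :
    ∃ (m : ℕ) (G : SimpleGraph (Fin m)), IsThreeConnected G ∧ IsCubic G ∧ IsPlanar G ∧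
      CycleLengths G = CycleLengths M.graph := by
  have e := Fintype.equivFin V
  have hc := M.congr_conn e hM
  have h3' : 3 < Nat.card (Fin (Fintype.card V)) := by simpa using h3
  exact ⟨_, (M.congr e).graph, isThreeConnected _ hc h3', isCubic _,
    isPlanar _ hc h3' (by simpa [congr_numFaces] using he),
    (cycleLengths_subset_of_iso (M.congrIso e).symm).antisymm
      (cycleLengths_subset_of_iso (M.congrIso e))⟩

/-- Every edge lies on a cycle. -/
lemma exists_cycle (hM : M.Conn) (x : V × Fin 3) :
    ∃ (v : V) (w : M.graph.Walk v v), w.IsCycle ∧ s(x.1, (M.opp x).1) ∈ w.edges := by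
  by_contra! h
  have hb := (SimpleGraph.isBridge_iff_forall_cycle_notMem (M.adj_opp x)).2
    (fun u p hp => h u p hp)
  rw [SimpleGraph.isBridge_iff] at hb
  refine hb ?_
  obtain ⟨u, i⟩ := x
  set v := (M.opp (u, i)).1 with hv
  have hvu : v ≠ u := M.opp_ne u i
  obtain ⟨j, hj⟩ : ∃ j, j ≠ i := exists_ne i
  have hjv : (M.opp (u, j)).1 ≠ v := fun h => hj (M.opp_inj u j i h)
  have key := hM u u (fun w => (M.graph.deleteEdges {s(u, v)}).Reachable v w) ?_ v
    (M.opp (u, j)).1 hvu hvu (M.opp_ne u j) (M.opp_ne u j)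
  · refine ((key.1 (SimpleGraph.Reachable.refl _)).trans (SimpleGraph.Adj.reachable ?_)).symm
    rw [SimpleGraph.deleteEdges_adj]
    refine ⟨(M.adj_opp (u, j)).symm, ?_⟩
    simp only [Set.mem_singleton_iff, Sym2.eq_iff, not_or, not_and]
    exact ⟨fun h => absurd h (M.opp_ne u j), fun h => absurd h hjv⟩
  · intro w k h1 _ h2 _
    have hadj : (M.graph.deleteEdges {s(u, v)}).Adj w (M.opp (w, k)).1 := by
      rw [SimpleGraph.deleteEdges_adj]
      refine ⟨M.adj_opp (w, k), ?_⟩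
      simp only [Set.mem_singleton_iff, Sym2.eq_iff, not_or, not_and]
      exact ⟨fun h => absurd h h1, fun _ h => absurd h h2⟩
    exact ⟨fun h => h.trans hadj.reachable, fun h => h.trans hadj.symm.reachable⟩

end Transport

lemma graph_adj {V : Type} (M : CubicMap V) (u v : V) :
    M.graph.Adj u v ↔ ∃ i, (M.opp (u, i)).1 = v := Iff.rfl

namespace Realization

variable {A : Type} [DecidableEq A] [Fintype A] {H : CubicMap A} {W : A × Fin 3 → ℕ}
  {size : A → ℕ} {T : Set A}

lemma proj_eq_of_walk (R : Realization H W size T) {u v : R.V} (w : R.M.graph.Walk u v)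
    (hw : ∀ x, s((R.tip x).1, (R.M.opp (R.tip x)).1) ∉ w.edges) :
    ∀ y ∈ w.support, R.proj y = R.proj v := by
  induction w with
  | nil => simp
  | cons h p ih =>
    have hi := h
    rw [graph_adj] at hi
    obtain ⟨i, hi⟩ := hi
    have ih' := ih fun x hx => hw x (by simp [hx])
    intro y hy
    rcases List.mem_cons.1 hy with rfl | hy
    · rw [← ih' _ p.start_mem_support, ← hi, R.proj_opp]
      rintro ⟨x, hx⟩
      refine hw x ?_
      rw [hx, hi]
      simp
    · exact ih' y hy

lemma three_lt_card (R : Realization H W size Set.univ) (hA : 1 < Fintype.card A) :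
    3 < Nat.card R.V := by
  have hinj : Function.Injective fun x => (R.tip x).1 := fun x y h => by
    simpa using R.eq_or_of_tip_fst_eq x y h
  have := Fintype.card_le_of_injective _ hinj
  rw [Fintype.card_prod, Fintype.card_fin] at this
  rw [Nat.card_eq_fintype_card]
  omega

/-- A cycle stays within a fragment or has length at least half of the weight of its tips. -/
lemma length_cases (R : Realization H W size T) {v : R.V} (w : R.M.graph.Walk v v)
    (hw : w.IsCycle) :
    ((∃ a, w.length ≤ size a) ∧ ∀ x, s((R.tip x).1, (R.M.opp (R.tip x)).1) ∉ w.edges) ∨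
      ∃ z, H.IsEven z ∧ (∃ x, z x = true) ∧
      (∑ x, if z x then W x else 0) ≤ 2 * w.length := by
  classical
  obtain ⟨z, hz, hzw⟩ := R.M.exists_isEven w hw
  by_cases h : ∃ x, (z ∘ R.tip) x = true
  · exact Or.inr ⟨z ∘ R.tip, R.even_tip z hz, h,
      (R.sum_le z hz).trans (Nat.mul_le_mul_left 2 (R.M.card_used_le_length w hzw))⟩
  · push Not at h
    have hno : ∀ x, s((R.tip x).1, (R.M.opp (R.tip x)).1) ∉ w.edges :=
      fun x hx => h x ((hzw _).2 hx)
    have hp := R.proj_eq_of_walk w hno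
    refine Or.inl ⟨⟨R.proj v, ?_⟩, hno⟩
    calc w.length = w.support.tail.length := by simp
      _ = w.support.tail.toFinset.card := (List.toFinset_card_of_nodup hw.support_nodup).symm
      _ ≤ (Finset.univ.filter fun y => R.proj y = R.proj v).card := by
          refine Finset.card_le_card fun y hy => ?_
          simpa using hp y (List.mem_of_mem_tail (List.mem_toFinset.1 hy))
      _ ≤ size (R.proj v) := by
          rw [Finset.card_filter]
          exact R.sum_fiber_le _

end Realization

/-- A cubic map with weighted ports, in which every even port set is heavy, yields a counterexample. -/
theorem exists_counterexample {A : Type} [DecidableEq A] [Fintype A] {H : CubicMap A}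
    (hA : 1 < Fintype.card A) (hH : H.Conn) (he : 2 * H.numFaces = Fintype.card A + 4)
    (n : A × Fin 3 → ℕ) (k : ℕ) (hn : ∀ a, 3 + 2 * ∑ i, n (a, i) < k)
    (hz : ∀ z, H.IsEven z → (∃ x, z x = true) → 2 * k + 3 ≤ ∑ x, if z x then 1 + n x else 0) :
    ∃ (m : ℕ) (G : SimpleGraph (Fin m)),
      IsThreeConnected G ∧ IsCubic G ∧ IsPlanar G ∧ CircumferenceAtLeast G k ∧
      ∀ ℓ ∈ CycleLengths G, ¬(k ≤ ℓ ∧ ℓ ≤ 2 * k + 2) := by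
  obtain ⟨R⟩ := Realization.nonempty hH he n
  obtain ⟨m, G, h1, h2, h3, h4⟩ := R.M.exists_fin R.conn (R.three_lt_card hA) R.euler
  have key : ∀ (v : R.V) (w : R.M.graph.Walk v v), w.IsCycle →
      (w.length < k ∧ ∀ x, s((R.tip x).1, (R.M.opp (R.tip x)).1) ∉ w.edges) ∨
        2 * k + 3 ≤ w.length := by
    intro v w hw
    rcases R.length_cases w hw with ⟨⟨a, ha⟩, hno⟩ | ⟨z, hze, hzx, hle⟩
    · exact Or.inl ⟨ha.trans_lt (hn a), hno⟩
    · have h5 := hz z hze hzx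
      have h6 : (∑ x, if z x then 2 + 2 * n x else 0) = 2 * ∑ x, if z x then 1 + n x else 0 := by
        rw [Finset.mul_sum]
        refine Finset.sum_congr rfl fun x _ => ?_
        split_ifs <;> ring
      omega
  refine ⟨m, G, h1, h2, h3, ?_, ?_⟩
  · obtain ⟨a⟩ : Nonempty A := Fintype.card_pos_iff.1 (by omega)
    obtain ⟨v, w, hw, hx⟩ := R.M.exists_cycle R.conn (R.tip (a, 0))
    refine ⟨w.length, h4 ▸ ⟨v, w, hw, rfl⟩, ?_⟩
    rcases key v w hw with h | h
    · exact absurd hx (h.2 _)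
    · omega
  · rw [h4]
    rintro ℓ ⟨v, w, hw, rfl⟩
    rcases key v w hw with h | h <;> omega

/-! ### The base map -/

/-- The vertices of the base map: two halves, each with `d` columns of four vertices. -/
abbrev BaseVert (d : ℕ) : Type := Bool × Fin 4 × ZMod d

namespace BaseVert

variable {d : ℕ}

/-- The port matching of the base map. -/
def opp : BaseVert d × Fin 3 → BaseVert d × Fin 3
  | ((h, 0, j), 0) => ((h, 1, j), 0)
  | ((h, 0, j), 1) => ((h, 0, j + 1), 2)
  | ((h, 0, j), 2) => ((h, 0, j - 1), 1)
  | ((h, 1, j), 0) => ((h, 0, j), 0)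
  | ((h, 1, j), 1) => ((h, 2, j - 1), 1)
  | ((h, 1, j), 2) => ((h, 2, j), 2)
  | ((h, 2, j), 0) => ((h, 3, j), 0)
  | ((h, 2, j), 1) => ((h, 1, j + 1), 1)
  | ((h, 2, j), 2) => ((h, 1, j), 2)
  | ((h, 3, j), 0) => ((h, 2, j), 0)
  | ((h, 3, j), 1) => ((!h, 3, 1 - j), 1)
  | ((h, 3, j), 2) => ((!h, 3, -j), 2)

section

variable (h : Bool) (j : ZMod d)

@[simp] lemma opp_zero_zero : opp ((h, 0, j), 0) = ((h, 1, j), 0) := rfl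
@[simp] lemma opp_zero_one : opp ((h, 0, j), 1) = ((h, 0, j + 1), 2) := rfl
@[simp] lemma opp_zero_two : opp ((h, 0, j), 2) = ((h, 0, j - 1), 1) := rfl
@[simp] lemma opp_one_zero : opp ((h, 1, j), 0) = ((h, 0, j), 0) := rfl
@[simp] lemma opp_one_one : opp ((h, 1, j), 1) = ((h, 2, j - 1), 1) := rfl
@[simp] lemma opp_one_two : opp ((h, 1, j), 2) = ((h, 2, j), 2) := rfl
@[simp] lemma opp_two_zero : opp ((h, 2, j), 0) = ((h, 3, j), 0) := rfl
@[simp] lemma opp_two_one : opp ((h, 2, j), 1) = ((h, 1, j + 1), 1) := rfl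
@[simp] lemma opp_two_two : opp ((h, 2, j), 2) = ((h, 1, j), 2) := rfl
@[simp] lemma opp_three_zero : opp ((h, 3, j), 0) = ((h, 2, j), 0) := rfl
@[simp] lemma opp_three_one : opp ((h, 3, j), 1) = ((!h, 3, 1 - j), 1) := rfl
@[simp] lemma opp_three_two : opp ((h, 3, j), 2) = ((!h, 3, -j), 2) := rfl

end

lemma forall_vert {P : BaseVert d → Prop}
    (hP : ∀ h j, P (h, 0, j) ∧ P (h, 1, j) ∧ P (h, 2, j) ∧ P (h, 3, j)) (v : BaseVert d) : P v := by
  obtain ⟨h, q, j⟩ := v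
  obtain ⟨h0, h1, h2, h3⟩ := hP h j
  revert q
  simp only [Fin.forall_fin_succ, IsEmpty.forall_iff, and_true]
  exact ⟨h0, h1, h2, h3⟩

lemma forall_fin_three {P : Fin 3 → Prop} : (∀ i, P i) ↔ P 0 ∧ P 1 ∧ P 2 := by
  simp [Fin.forall_fin_succ]

lemma forall_port {P : BaseVert d × Fin 3 → Prop}
    (hP : ∀ h j, (P ((h, 0, j), 0) ∧ P ((h, 0, j), 1) ∧ P ((h, 0, j), 2)) ∧
      (P ((h, 1, j), 0) ∧ P ((h, 1, j), 1) ∧ P ((h, 1, j), 2)) ∧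
      (P ((h, 2, j), 0) ∧ P ((h, 2, j), 1) ∧ P ((h, 2, j), 2)) ∧
      (P ((h, 3, j), 0) ∧ P ((h, 3, j), 1) ∧ P ((h, 3, j), 2))) (x : BaseVert d × Fin 3) :
    P x := by
  obtain ⟨v, i⟩ := x
  revert i
  revert v
  refine forall_vert fun h j => ?_
  simpa only [forall_fin_three] using hP h j

end BaseVert

open BaseVert

lemma ZMod.natCast_ne_zero_of_lt {d n : ℕ} (h0 : 0 < n) (h : n < d) : (n : ZMod d) ≠ 0 := by
  rw [Ne, ZMod.natCast_eq_zero_iff]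
  exact Nat.not_dvd_of_pos_of_lt h0 h

/-- The base map. -/
def baseMap (d : ℕ) (hd : 3 ≤ d) : CubicMap (BaseVert d) where
  opp := BaseVert.opp
  opp_opp := forall_port (by simp)
  opp_ne v i := by
    have h1 : (1 : ZMod d) ≠ 0 := by
      exact_mod_cast ZMod.natCast_ne_zero_of_lt one_pos (by omega : 1 < d)
    refine forall_port (P := fun x => (BaseVert.opp x).1 ≠ x.1) ?_ (v, i)
    simp [h1]
  opp_inj := by
    have h1 : (1 : ZMod d) ≠ 0 := by
      exact_mod_cast ZMod.natCast_ne_zero_of_lt one_pos (by omega : 1 < d)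
    have h2 : (2 : ZMod d) ≠ 0 := by
      exact_mod_cast ZMod.natCast_ne_zero_of_lt two_pos (by omega : 2 < d)
    have h3 : ∀ j : ZMod d, j + 1 ≠ j - 1 := fun j h => h2 (by linear_combination h)
    have h4 : ∀ j : ZMod d, j - 1 ≠ j + 1 := fun j h => h3 j h.symm
    have h5 : ∀ j : ZMod d, 1 - j ≠ -j := fun j h => h1 (by linear_combination h)
    have h6 : ∀ j : ZMod d, -j ≠ 1 - j := fun j h => h5 j h.symm
    have h7 : ∀ j : ZMod d, j ≠ j - 1 := fun j h => h1 (by linear_combination h)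
    refine forall_vert fun h j => ?_
    simp [forall_fin_three, h1, h3, h4, h5, h6, h7]

@[simp] lemma baseMap_opp (d : ℕ) (hd : 3 ≤ d) : (baseMap d hd).opp = BaseVert.opp := rfl

section Faces

variable {d : ℕ} (hd : 3 ≤ d)

/-- The faces of the base map: `inl (h, false, j)` are the pentagons, `inl (h, true, j)` the hexagons,
and `inr h` the two large faces. -/
abbrev BaseFace (d : ℕ) : Type := (Bool × Bool × ZMod d) ⊕ Bool

/-- The face containing a port. -/
def baseLabel : BaseVert d × Fin 3 → BaseFace d
  | ((h, 0, j), 0) => Sum.inl (h, false, j - 1)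
  | ((h, 0, j), 1) => Sum.inl (h, false, j)
  | ((h, 0, _), 2) => Sum.inr h
  | ((h, 1, j), 0) => Sum.inl (h, false, j)
  | ((h, 1, j), 1) => Sum.inl (h, false, j - 1)
  | ((h, 1, j), 2) => Sum.inl (h, true, j)
  | ((h, 2, j), 0) => Sum.inl (h, true, j)
  | ((h, 2, j), 1) => Sum.inl (h, true, j + 1)
  | ((h, 2, j), 2) => Sum.inl (h, false, j)
  | ((h, 3, j), 0) => Sum.inl (h, true, j + 1)
  | ((h, 3, j), 1) => Sum.inl (h, true, j)
  | ((h, 3, j), 2) => Sum.inl (!h, true, 1 - j)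

/-- A port on a given face. -/
def baseRep : BaseFace d → BaseVert d × Fin 3
  | Sum.inl (h, false, j) => ((h, 0, j), 1)
  | Sum.inl (h, true, j) => ((h, 1, j), 2)
  | Sum.inr h => ((h, 0, 0), 2)

lemma baseMap_numFaces : (baseMap d hd).numFaces = 4 * d + 2 := by
  have : NeZero d := ⟨by omega⟩
  have hstep : ∀ x y, (baseMap d hd).face x = y → (baseMap d hd).face.SameCycle x y := by
    rintro x y rfl
    exact ⟨1, by simp⟩
  rw [numFaces, card_quotient_sameCycle _ baseLabel baseRep]
  · simp [BaseFace]
    ring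
  · refine forall_port fun h j => ?_
    simp [baseLabel, neg_add_eq_sub]
  · rintro (⟨h, _ | _, j⟩ | h) <;> rfl
  · have p1 : ∀ h j, (baseMap d hd).face.SameCycle ((h, 0, j), 1) ((h, 0, j + 1), 0) :=
      fun h j => hstep _ _ (by simp)
    have p2 : ∀ h j, (baseMap d hd).face.SameCycle ((h, 0, j), 0) ((h, 1, j), 1) :=
      fun h j => hstep _ _ (by simp)
    have p3 : ∀ h j, (baseMap d hd).face.SameCycle ((h, 1, j + 1), 1) ((h, 2, j), 2) :=
      fun h j => hstep _ _ (by simp)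
    have p4 : ∀ h j, (baseMap d hd).face.SameCycle ((h, 2, j), 2) ((h, 1, j), 0) :=
      fun h j => hstep _ _ (by simp)
    have q1 : ∀ h j, (baseMap d hd).face.SameCycle ((h, 1, j), 2) ((h, 2, j), 0) :=
      fun h j => hstep _ _ (by simp)
    have q2 : ∀ h j, (baseMap d hd).face.SameCycle ((h, 2, j), 0) ((h, 3, j), 1) :=
      fun h j => hstep _ _ (by simp)
    have q3 : ∀ h j, (baseMap d hd).face.SameCycle ((h, 3, j), 1) ((!h, 3, 1 - j), 2) :=
      fun h j => hstep _ _ (by simp)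
    have q4 : ∀ h j, (baseMap d hd).face.SameCycle ((!h, 3, 1 - (j + 1)), 2) ((h, 3, j), 0) :=
      fun h j => hstep _ _ (by simp)
    have q5 : ∀ h j, (baseMap d hd).face.SameCycle ((h, 3, j), 0) ((h, 2, j), 1) :=
      fun h j => hstep _ _ (by simp)
    have r1 : ∀ h j, (baseMap d hd).face.SameCycle ((h, 0, j), 2) ((h, 0, j - 1), 2) :=
      fun h j => hstep _ _ (by simp)
    have r2 : ∀ h (n : ℕ), (baseMap d hd).face.SameCycle ((h, 0, 0), 2) ((h, 0, -n), 2) := by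
      intro h n
      induction n with
      | zero => simpa using Equiv.Perm.SameCycle.refl _ _
      | succ n ih =>
        convert ih.trans (r1 h _) using 4
        push_cast
        ring
    have t3 : ∀ h j, (baseMap d hd).face.SameCycle ((h, 0, j), 1) ((h, 1, j + 1), 1) :=
      fun h j => (p1 h j).trans (p2 h _)
    have t4 : ∀ h j, (baseMap d hd).face.SameCycle ((h, 0, j), 1) ((h, 2, j), 2) :=
      fun h j => (t3 h j).trans (p3 h _)
    have u3 : ∀ h j, (baseMap d hd).face.SameCycle ((h, 1, j), 2) ((h, 3, j), 1) :=
      fun h j => (q1 h j).trans (q2 h j)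
    have u4 : ∀ h j, (baseMap d hd).face.SameCycle ((h, 1, j), 2) ((!h, 3, 1 - j), 2) :=
      fun h j => (u3 h j).trans (q3 h j)
    have u5 : ∀ h j, (baseMap d hd).face.SameCycle ((h, 1, j + 1), 2) ((h, 3, j), 0) :=
      fun h j => (u4 h _).trans (q4 h j)
    refine forall_port fun h j => ⟨⟨?_, ?_, ?_⟩, ⟨?_, ?_, ?_⟩, ⟨?_, ?_, ?_⟩, ⟨?_, ?_, ?_⟩⟩
    · simpa [baseLabel, baseRep] using p1 h (j - 1)
    · exact Equiv.Perm.SameCycle.refl _ _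
    · simpa [baseLabel, baseRep] using r2 h (-j).val
    · exact (t4 h j).trans (p4 h j)
    · simpa [baseLabel, baseRep] using t3 h (j - 1)
    · exact Equiv.Perm.SameCycle.refl _ _
    · exact q1 h j
    · exact (u5 h j).trans (q5 h j)
    · exact t4 h j
    · exact u5 h j
    · exact u3 h j
    · simpa [baseLabel, baseRep] using u4 (!h) (1 - j)

end Faces

section Connectivity

variable {d : ℕ}

/-- A cyclic arrangement that is deleted in at most one column stays monochromatic. -/
lemma ring_const {A : Type} (hd : 3 ≤ d) (X Y : ZMod d → A) (del f : A → Prop)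
    (hXY : ∀ i, ¬del (X i) → ¬del (Y i) → (f (X i) ↔ f (Y i)))
    (hYX : ∀ i, ¬del (Y i) → ¬del (X (i + 1)) → (f (Y i) ↔ f (X (i + 1))))
    (k : ZMod d) (hk : ∀ i, i ≠ k → ¬del (X i) ∧ ¬del (Y i)) :
    ∃ c : Prop, ∀ i, (¬del (X i) → (f (X i) ↔ c)) ∧ (¬del (Y i) → (f (Y i) ↔ c)) := by
  have : NeZero d := ⟨by omega⟩
  have hne : ∀ n : ℕ, n + 1 < d → k + 1 + n ≠ k := by
    intro n hn h
    refine ZMod.natCast_ne_zero_of_lt (Nat.succ_pos n) hn ?_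
    push_cast
    linear_combination h
  have h1 : ∀ n : ℕ, n + 1 < d → (f (X (k + 1 + n)) ↔ f (X (k + 1))) := by
    intro n
    induction n with
    | zero => simp
    | succ n ih =>
      intro hn
      have h2 := hk _ (hne n (by omega))
      have h3 := hk _ (hne (n + 1) hn)
      have h4 : k + 1 + ((n + 1 : ℕ) : ZMod d) = k + 1 + n + 1 := by push_cast; ring
      rw [← ih (by omega), hXY _ h2.1 h2.2, h4, hYX _ h2.2 (h4 ▸ h3.1)]
  have h2 : ∀ i, i ≠ k → (f (X i) ↔ f (X (k + 1))) := by
    intro i hi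
    have h3 : ((i - (k + 1)).val : ZMod d) = i - (k + 1) := ZMod.natCast_rightInverse _
    have h4 : k + 1 + ((i - (k + 1)).val : ZMod d) = i := by rw [h3]; ring
    rw [← h1 (i - (k + 1)).val, h4]
    refine lt_of_le_of_ne (ZMod.val_lt _) fun h => hi ?_
    have h5 := congrArg (Nat.cast : ℕ → ZMod d) h
    push_cast at h5
    rw [ZMod.natCast_self, h3] at h5
    linear_combination h5
  have h3 : ∀ i, i ≠ k → (f (Y i) ↔ f (X (k + 1))) := by
    intro i hi
    rw [← hXY i (hk i hi).1 (hk i hi).2, h2 i hi]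
  have h10 : (1 : ZMod d) ≠ 0 := by
    exact_mod_cast ZMod.natCast_ne_zero_of_lt one_pos (by omega : 1 < d)
  refine ⟨f (X (k + 1)), fun i => ?_⟩
  by_cases hi : i = k
  · subst hi
    have h4 : i - 1 ≠ i := fun h => h10 (by linear_combination -h)
    have h5 : i + 1 ≠ i := fun h => h10 (by linear_combination h)
    refine ⟨fun hx => ?_, fun hy => ?_⟩
    · have := hYX (i - 1) (hk _ h4).2 (by simpa using hx)
      rw [sub_add_cancel] at this
      rw [← this, h3 _ h4]
    · rw [hYX i hy (hk _ h5).1]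
  · exact ⟨fun _ => h2 i hi, fun _ => h3 i hi⟩

/-- The base map is covered by five disjoint rings. -/
def ringX : Option (Bool × Bool) → ZMod d → BaseVert d
  | some (h, false), i => (h, 0, i)
  | some (h, true), i => (h, 1, i)
  | none, i => (false, 3, -i)

/-- The second vertex of a ring in each column. -/
def ringY : Option (Bool × Bool) → ZMod d → BaseVert d
  | some (h, false), i => (h, 0, i)
  | some (h, true), i => (h, 2, i)
  | none, i => (true, 3, 1 + i)

/-- The ring containing a vertex. -/
def ringOf : BaseVert d → Option (Bool × Bool)
  | (h, 0, _) => some (h, false)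
  | (h, 1, _) => some (h, true)
  | (h, 2, _) => some (h, true)
  | (_, 3, _) => none

lemma exists_ring (v : BaseVert d) : ∃ i, v = ringX (ringOf v) i ∨ v = ringY (ringOf v) i := by
  revert v
  refine forall_vert fun h j => ⟨⟨j, Or.inl rfl⟩, ⟨j, Or.inl rfl⟩, ⟨j, Or.inr rfl⟩, ?_⟩
  cases h
  · exact ⟨-j, Or.inl (by simp [ringX, ringOf])⟩
  · exact ⟨j - 1, Or.inr (by simp [ringY, ringOf])⟩

lemma ring_inj {l m : Option (Bool × Bool)} {i j : ZMod d}
    (h : (ringX l i = ringX m j ∨ ringX l i = ringY m j) ∨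
      (ringY l i = ringX m j ∨ ringY l i = ringY m j)) : l = m ∧ i = j := by
  rcases l with _ | ⟨l, _ | _⟩ <;> rcases m with _ | ⟨m, _ | _⟩ <;>
    simp_all [ringX, ringY]

lemma baseMap_conn (hd : 5 ≤ d) : (baseMap d (by omega)).Conn := by
  have : NeZero d := ⟨by omega⟩
  intro a b f hf
  rw [baseMap_opp] at hf
  set del : BaseVert d → Prop := fun v => v = a ∨ v = b with hdel
  have hf' : ∀ v i, ¬del v → ¬del (BaseVert.opp (v, i)).1 →
      (f v ↔ f (BaseVert.opp (v, i)).1) := by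
    intro v i h1 h2
    simp only [hdel, not_or] at h1 h2
    exact hf v i h1.1 h1.2 h2.1 h2.2
  -- an intact full column
  obtain ⟨j, hj⟩ : ∃ j : ZMod d, ∀ h q, ¬del (h, q, j) ∧ ¬del (h, q, -j) := by
    obtain ⟨j, hj⟩ : ∃ j : ZMod d, j ∉ ({a.2.2, -a.2.2, b.2.2, -b.2.2} : Finset (ZMod d)) := by
      by_contra! h
      have h1 : Finset.univ ⊆ ({a.2.2, -a.2.2, b.2.2, -b.2.2} : Finset (ZMod d)) :=
        fun x _ => h x
      have h2 := (Finset.card_le_card h1).trans Finset.card_le_four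
      rw [Finset.card_univ, ZMod.card] at h2
      omega
    simp only [Finset.mem_insert, Finset.mem_singleton, not_or] at hj
    obtain ⟨h1, h2, h3, h4⟩ := hj
    refine ⟨j, fun h q => ⟨?_, ?_⟩⟩
    · rintro (rfl | rfl)
      · exact h1 rfl
      · exact h3 rfl
    · rintro (rfl | rfl)
      · exact h2 (neg_neg j).symm
      · exact h4 (neg_neg j).symm
  set c : Prop := f (false, 3, j) with hc
  have hcol : ∀ l, ∃ i, ¬del (ringX l i) ∧ (f (ringX l i) ↔ c) := by
    have m0 : f (true, 3, -j) ↔ c := (hf' (false, 3, j) 2 (hj _ _).1 (hj _ _).2).symm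
    have h0 : ∀ h i, ¬del (h, 0, i) → ¬del (h, 1, i) → ¬del (h, 2, i) → ¬del (h, 3, i) →
        (f (h, 3, i) ↔ c) → (f (h, 1, i) ↔ c) ∧ (f (h, 0, i) ↔ c) := by
      intro h i d0 d1 d2 d3 h3
      have e2 := hf' (h, 3, i) 0 d3 d2
      have e1 := hf' (h, 2, i) 2 d2 d1
      have e0 := hf' (h, 1, i) 0 d1 d0
      simp only [opp_three_zero, opp_two_two, opp_one_zero] at e2 e1 e0
      rw [← e0, ← e1, ← e2]
      exact ⟨h3, h3⟩
    have hF := h0 false j (hj _ _).1 (hj _ _).1 (hj _ _).1 (hj _ _).1 Iff.rfl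
    have hT := h0 true (-j) (hj _ _).2 (hj _ _).2 (hj _ _).2 (hj _ _).2 m0
    rintro (_ | ⟨_ | _, _ | _⟩)
    · exact ⟨-j, by simpa [ringX] using (hj false 3).1, by simp [ringX, hc]⟩
    · exact ⟨j, (hj _ _).1, hF.2⟩
    · exact ⟨j, (hj _ _).1, hF.1⟩
    · exact ⟨-j, (hj _ _).2, hT.2⟩
    · exact ⟨-j, (hj _ _).2, hT.1⟩
  have hgood : ∀ l, (∃ k, ∀ i, i ≠ k → ¬del (ringX l i) ∧ ¬del (ringY l i)) →
      ∀ v, ringOf v = l → ¬del v → (f v ↔ c) := by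
    rintro l ⟨k, hk⟩ v rfl hv
    obtain ⟨c', hc'⟩ := ring_const (by omega) (ringX (ringOf v)) (ringY (ringOf v)) del f
      (by
        rcases ringOf v with _ | ⟨h, _ | _⟩
        · intro i h1 h2
          have := hf' (ringX none i) 1 h1
          simp only [ringX, opp_three_one, sub_neg_eq_add] at this
          exact this h2
        · exact fun _ _ _ => Iff.rfl
        · exact fun i h1 h2 => hf' (h, 1, i) 2 h1 h2)
      (by
        rcases ringOf v with _ | ⟨h, _ | _⟩
        · intro i h1 h2
          have := hf' (ringY none i) 2 h1
          simp only [ringY, opp_three_two] at this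
          simp only [ringX, ringY, add_comm i 1] at h2 ⊢
          exact this h2
        · exact fun i h1 h2 => hf' (h, 0, i) 1 h1 h2
        · exact fun i h1 h2 => hf' (h, 2, i) 1 h1 h2) k hk
    obtain ⟨i, hi, hic⟩ := hcol (ringOf v)
    have hcc : c' ↔ c := ((hc' i).1 hi).symm.trans hic
    obtain ⟨i, h | h⟩ := exists_ring v
    · have := (hc' i).1
      rw [← h] at this
      exact (this hv).trans hcc
    · have := (hc' i).2
      rw [← h] at this
      exact (this hv).trans hcc
  obtain ⟨ia, ha⟩ := exists_ring a
  obtain ⟨ib, hb⟩ := exists_ring b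
  have hin : ∀ l i, del (ringX l i) ∨ del (ringY l i) →
      (l = ringOf a ∧ i = ia) ∨ (l = ringOf b ∧ i = ib) := by
    rintro l i ((h | h) | (h | h))
    · exact Or.inl (ring_inj (Or.inl (ha.imp h.trans h.trans)))
    · exact Or.inr (ring_inj (Or.inl (hb.imp h.trans h.trans)))
    · exact Or.inl (ring_inj (Or.inr (ha.imp h.trans h.trans)))
    · exact Or.inr (ring_inj (Or.inr (hb.imp h.trans h.trans)))
  have hall : ∀ v, ¬del v → (f v ↔ c) := by
    intro v hv
    by_cases hg : ∃ k, ∀ i, i ≠ k → ¬del (ringX (ringOf v) i) ∧ ¬del (ringY (ringOf v) i)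
    · exact hgood _ hg v rfl hv
    · have hring : ringOf v = ringOf a ∧ ringOf v = ringOf b := by
        by_contra hne
        refine hg ?_
        by_cases h1 : ringOf v = ringOf a
        · refine ⟨ia, fun i hi => ?_⟩
          rw [← not_or]
          intro h
          rcases hin _ _ h with h | h
          · exact hi h.2
          · exact hne ⟨h1, h.1⟩
        · refine ⟨ib, fun i hi => ?_⟩
          rw [← not_or]
          intro h
          rcases hin _ _ h with h | h
          · exact h1 h.1
          · exact hi h.2
      have hother : ∀ w, ringOf w ≠ ringOf v → ¬del w ∧ (f w ↔ c) := by
        intro w hw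
        have hnd : ∀ i, ¬del (ringX (ringOf w) i) ∧ ¬del (ringY (ringOf w) i) := by
          intro i
          rw [← not_or]
          intro h
          rcases hin _ _ h with h | h
          · exact hw (h.1.trans hring.1.symm)
          · exact hw (h.1.trans hring.2.symm)
        have hwd : ¬del w := by
          rintro (rfl | rfl)
          · exact hw hring.1.symm
          · exact hw hring.2.symm
        exact ⟨hwd, hgood _ ⟨0, fun i _ => hnd i⟩ w rfl hwd⟩
      have hvert : ringOf (BaseVert.opp (v, 0)).1 ≠ ringOf v :=
        forall_vert (P := fun v => ringOf (BaseVert.opp (v, 0)).1 ≠ ringOf v)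
          (fun h j => by simp [ringOf]) v
      exact (hf' v 0 hv (hother _ hvert).1).trans (hother _ hvert).2
  intro u v h1 h2 h3 h4
  rw [hall u (by simp [hdel, h1, h2]), hall v (by simp [hdel, h3, h4])]

end Connectivity

section Weights

variable {d : ℕ}

/-- The number of additional truncations at each tip. -/
def weight (S : ℕ) : BaseVert d × Fin 3 → ℕ
  | ((_, 0, _), 0) => S - 3
  | ((_, 1, _), 0) => S - 3
  | ((_, 2, _), 0) => S - 4
  | ((_, 2, _), 1) => 1
  | ((_, 3, _), 0) => S - 3
  | _ => 0

lemma weight_sum_le {S : ℕ} (hS : 4 ≤ S) (v : BaseVert d) :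
    ∑ i, weight S (v, i) ≤ S - 3 := by
  revert v
  refine forall_vert fun h j => ?_
  simp only [Fin.sum_univ_three, weight]
  omega

/-- The weight of an even port set at a vertex. -/
def cost (S : ℕ) (z : BaseVert d × Fin 3 → Bool) (v : BaseVert d) : ℕ :=
  ∑ i, if z (v, i) then 1 + weight S (v, i) else 0

lemma cost_ge {S : ℕ} {z : BaseVert d × Fin 3 → Bool} {v : BaseVert d}
    {i j : Fin 3} (hij : i ≠ j) (hi : z (v, i) = true) (hj : z (v, j) = true) :
    2 + weight S (v, i) + weight S (v, j) ≤ cost S z v := by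
  calc 2 + weight S (v, i) + weight S (v, j)
      = ∑ k ∈ {i, j}, if z (v, k) then 1 + weight S (v, k) else 0 := by
        rw [Finset.sum_pair hij, if_pos hi, if_pos hj]
        ring
    _ ≤ cost S z v := Finset.sum_le_sum_of_subset (Finset.subset_univ _)

lemma exists_port_ne {y : Fin 3 → Bool} (h : ((y 0 ^^ y 1) ^^ y 2) = false) {i : Fin 3}
    (hi : y i = true) : ∃ j, i ≠ j ∧ y j = true := by
  revert y i
  decide

lemma list_sum_cost_le [NeZero d] (S : ℕ) (z : BaseVert d × Fin 3 → Bool) (l : List (BaseVert d))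
    (hl : l.Nodup) : (l.map (cost S z)).sum ≤ ∑ x, if z x then 1 + weight S x else 0 := by
  rw [Fintype.sum_prod_type, ← List.sum_toFinset _ hl]
  exact Finset.sum_le_sum_of_subset (Finset.subset_univ _)

/-- A coboundary on a cycle has an even number of ones. -/
lemma exists_ne_of_coboundary [NeZero d] {v t : ZMod d → Bool} (h : ∀ j, v j = (t j ^^ t (j - 1)))
    {j : ZMod d} (hj : v j = true) : ∃ i, j ≠ i ∧ v i = true := by
  by_contra! hno
  have h1 : ∑ i, ((v i).toNat : ZMod 2) = 1 := by
    rw [Finset.sum_eq_single j]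
    · simp [hj]
    · intro i _ hi
      simp [Bool.eq_false_iff.2 (hno i hi.symm)]
    · simp
  have h2 : ∀ a b : Bool, ((a ^^ b).toNat : ZMod 2) = a.toNat + b.toNat := by decide
  simp only [h, h2, Finset.sum_add_distrib] at h1
  have h3 : ∑ i, ((t (i - 1)).toNat : ZMod 2) = ∑ i, ((t i).toNat : ZMod 2) :=
    Equiv.sum_comp (Equiv.subRight 1) fun i => ((t i).toNat : ZMod 2)
  rw [h3, CharTwo.add_self_eq_zero] at h1
  exact zero_ne_one h1

/-- A function on a cycle without steps is constant. -/
lemma eq_true_of_step [NeZero d] {t : ZMod d → Bool} (h : ∀ j, t (j - 1) = t j) {j : ZMod d}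
    (hj : t j = true) (i : ZMod d) : t i = true := by
  have h1 : ∀ n : ℕ, t (j - n) = true := by
    intro n
    induction n with
    | zero => simpa using hj
    | succ n ih =>
      rw [← ih, ← h (j - n)]
      congr 1
      push_cast
      ring
  simpa using h1 (j - i).val

section

variable {S : ℕ} {hd : 3 ≤ d} {z : BaseVert d × Fin 3 → Bool}

lemma two_le_cost (hz : (baseMap d hd).IsEven z) {v : BaseVert d} {i : Fin 3}
    (hi : z (v, i) = true) : 2 ≤ cost S z v := by
  obtain ⟨j, hij, hj⟩ := exists_port_ne (y := fun i => z (v, i)) (hz.2 v) hi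
  have := cost_ge (S := S) hij hi hj
  omega

lemma weight_le_cost (hz : (baseMap d hd).IsEven z) {v : BaseVert d} {i : Fin 3}
    (hi : z (v, i) = true) : 2 + weight S (v, i) ≤ cost S z v := by
  obtain ⟨j, hij, hj⟩ := exists_port_ne (y := fun i => z (v, i)) (hz.2 v) hi
  have := cost_ge (S := S) hij hi hj
  omega

lemma three_le_cost (hS : 8 ≤ S) (hz : (baseMap d hd).IsEven z) {h : Bool} {j : ZMod d} {i : Fin 3}
    (hi : z ((h, 2, j), i) = true) : 3 ≤ cost S z (h, 2, j) := by
  obtain ⟨k, hik, hk⟩ := exists_port_ne (y := fun i => z ((h, 2, j), i)) (hz.2 _) hi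
  have h1 := cost_ge (S := S) hik hi hk
  have h2 : ∀ i k : Fin 3, i ≠ k →
      1 ≤ weight S ((h, 2, j), i) + weight S ((h, 2, j), k) := by
    simp only [forall_fin_three, weight]
    simp
    omega
  have := h2 i k hik
  omega

variable [NeZero d]

lemma bound_upper (hS : 8 ≤ S) (hz : (baseMap d hd).IsEven z) {h : Bool} {j : ZMod d}
    (hj : z ((h, 0, j), 0) = true) : 4 * S - 1 ≤ ∑ x, if z x then 1 + weight S x else 0 := by
  obtain ⟨i, hij, hi⟩ : ∃ i, j ≠ i ∧ z ((h, 0, i), 0) = true := by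
    refine exists_ne_of_coboundary (v := fun j => z ((h, 0, j), 0))
      (t := fun j => z ((h, 0, j), 1)) (fun j => ?_) hj
    have h1 := hz.2 (h, 0, j)
    have h2 : z ((h, 0, j - 1), 1) = z ((h, 0, j), 2) := hz.1 ((h, 0, j), 2)
    rw [← h2] at h1
    revert h1
    cases z ((h, 0, j), 0) <;> cases z ((h, 0, j), 1) <;> cases z ((h, 0, j - 1), 1) <;> simp
  have hU : ∀ j, z ((h, 0, j), 0) = true → z ((h, 1, j), 0) = true :=
    fun j hj => (hz.1 ((h, 0, j), 0)).trans hj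
  obtain ⟨k, hk⟩ : ∃ k, 3 ≤ cost S z (h, 2, k) := by
    obtain ⟨p, hp0, hp⟩ := exists_port_ne (y := fun i => z ((h, 1, j), i)) (hz.2 _) (hU j hj)
    have h1 := hz.1 ((h, 1, j), p)
    rw [hp] at h1
    revert p
    simp only [forall_fin_three]
    refine ⟨by simp, fun _ _ h1 => ?_, fun _ _ h1 => ?_⟩
    · exact ⟨_, three_le_cost hS hz h1⟩
    · exact ⟨_, three_le_cost hS hz h1⟩
  have h1 := weight_le_cost (S := S) hz hj
  have h2 := weight_le_cost (S := S) hz hi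
  have h3 := weight_le_cost (S := S) hz (hU j hj)
  have h4 := weight_le_cost (S := S) hz (hU i hi)
  have h5 := list_sum_cost_le S z [(h, 0, j), (h, 0, i), (h, 1, j), (h, 1, i), (h, 2, k)]
    (by simp [hij])
  simp only [List.map_cons, List.map_nil, List.sum_cons, List.sum_nil] at h5
  simp only [weight] at h1 h2 h3 h4
  omega

lemma bound_lower (hS : 8 ≤ S) (hz : (baseMap d hd).IsEven z) {h : Bool}
    (hv : ∀ j, z ((h, 0, j), 0) = false) {j : ZMod d}
    (hj : z ((h, 2, j), 0) = true) : 4 * S - 1 ≤ ∑ x, if z x then 1 + weight S x else 0 := by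
  have hU : ∀ j, z ((h, 2, j), 2) = z ((h, 2, j - 1), 1) := by
    intro j
    have h0 := hz.2 (h, 1, j)
    have h1 : z ((h, 0, j), 0) = z ((h, 1, j), 0) := hz.1 ((h, 1, j), 0)
    have h2 : z ((h, 2, j - 1), 1) = z ((h, 1, j), 1) := hz.1 ((h, 1, j), 1)
    have h3 : z ((h, 2, j), 2) = z ((h, 1, j), 2) := hz.1 ((h, 1, j), 2)
    rw [← h1, ← h2, ← h3, hv j] at h0
    revert h0
    cases z ((h, 2, j - 1), 1) <;> cases z ((h, 2, j), 2) <;> simp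
  obtain ⟨i, hij, hi⟩ : ∃ i, j ≠ i ∧ z ((h, 2, i), 0) = true := by
    refine exists_ne_of_coboundary (v := fun j => z ((h, 2, j), 0))
      (t := fun j => z ((h, 2, j), 1)) (fun j => ?_) hj
    have h1 := hz.2 (h, 2, j)
    rw [hU] at h1
    revert h1
    cases z ((h, 2, j), 0) <;> cases z ((h, 2, j), 1) <;> cases z ((h, 2, j - 1), 1) <;> simp
  have hM : ∀ j, z ((h, 2, j), 0) = true → z ((h, 3, j), 0) = true :=
    fun j hj => (hz.1 ((h, 2, j), 0)).trans hj
  obtain ⟨k, hk⟩ : ∃ k, 2 ≤ cost S z (!h, 3, k) := by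
    obtain ⟨p, hp0, hp⟩ := exists_port_ne (y := fun i => z ((h, 3, j), i)) (hz.2 _) (hM j hj)
    have h1 := hz.1 ((h, 3, j), p)
    rw [hp] at h1
    revert p
    simp only [forall_fin_three]
    refine ⟨by simp, fun _ _ h1 => ?_, fun _ _ h1 => ?_⟩
    · exact ⟨_, two_le_cost hz h1⟩
    · exact ⟨_, two_le_cost hz h1⟩
  -- the two vertices of kind `2` and their neighbours of kind `1`
  have hD : ∀ j, z ((h, 2, j), 0) = true →
      (S - 1 ≤ cost S z (h, 2, j) ∧ ∃ l, 2 ≤ cost S z (h, 1, l)) ∨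
        (S - 2 ≤ cost S z (h, 2, j) ∧ 2 ≤ cost S z (h, 1, j)) := by
    intro j hj
    obtain ⟨p, hp0, hp⟩ := exists_port_ne (y := fun i => z ((h, 2, j), i)) (hz.2 _) hj
    have h1 := hz.1 ((h, 2, j), p)
    have h2 := cost_ge (S := S) hp0 hj hp
    rw [hp] at h1
    revert p
    simp only [forall_fin_three]
    refine ⟨by simp, fun _ _ h1 h2 => Or.inl ⟨?_, _, two_le_cost hz h1⟩,
      fun _ _ h1 h2 => Or.inr ⟨?_, two_le_cost hz h1⟩⟩ <;>
    · simp only [weight] at h2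
      omega
  have h1 := weight_le_cost (S := S) hz (hM j hj)
  have h2 := weight_le_cost (S := S) hz (hM i hi)
  have h3 := weight_le_cost (S := S) hz hj
  have h4 := weight_le_cost (S := S) hz hi
  have h6 : ∀ l, (S - 1 ≤ cost S z (h, 2, j) ∨ S - 1 ≤ cost S z (h, 2, i)) →
      2 ≤ cost S z (h, 1, l) → 4 * S - 1 ≤ ∑ x, if z x then 1 + weight S x else 0 := by
    intro l hl hl'
    have h5 := list_sum_cost_le S z
      [(h, 2, j), (h, 2, i), (h, 3, j), (h, 3, i), (!h, 3, k), (h, 1, l)] (by simp [hij])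
    simp only [List.map_cons, List.map_nil, List.sum_cons, List.sum_nil] at h5
    simp only [weight] at h1 h2 h3 h4
    omega
  rcases hD j hj with ⟨h7, l, hl⟩ | ⟨h7, hl⟩
  · exact h6 l (Or.inl h7) hl
  · rcases hD i hi with ⟨h8, l, hl'⟩ | ⟨h8, hl'⟩
    · exact h6 l (Or.inr h8) hl'
    · have h5 := list_sum_cost_le S z
        [(h, 2, j), (h, 2, i), (h, 3, j), (h, 3, i), (!h, 3, k), (h, 1, j), (h, 1, i)]
        (by simp [hij])
      simp only [List.map_cons, List.map_nil, List.sum_cons, List.sum_nil] at h5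
      simp only [weight] at h1 h2
      omega

lemma bound_ring (hz : (baseMap d hd).IsEven z) {h : Bool} {q : Fin 4} {p : Fin 3}
    (hq : ∀ j, z ((h, q, j), p) = true) : 2 * d ≤ ∑ x, if z x then 1 + weight S x else 0 := by
  have h1 := list_sum_cost_le S z ((Finset.univ : Finset (ZMod d)).toList.map fun j => (h, q, j))
    ((Finset.nodup_toList _).map fun _ _ h => by simpa using h)
  refine le_trans ?_ h1
  rw [List.map_map, Finset.sum_map_toList]
  calc 2 * d = ∑ _j : ZMod d, 2 := by simp [ZMod.card, mul_comm]
    _ ≤ _ := Finset.sum_le_sum fun j _ => two_le_cost hz (hq j)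

lemma weight_bound (hS : 8 ≤ S) (hdS : d = 2 * S) (hz : (baseMap d hd).IsEven z)
    (hne : ∃ x, z x = true) : 4 * S - 1 ≤ ∑ x, if z x then 1 + weight S x else 0 := by
  by_contra hlt
  have hT : ∀ h j, z ((h, 0, j), 0) = false := fun h j => by
    by_contra hj
    exact hlt (bound_upper hS hz (Bool.eq_true_of_not_eq_false hj))
  have hD : ∀ h j, z ((h, 2, j), 0) = false := fun h j => by
    by_contra hj
    exact hlt (bound_lower hS hz (hT h) (Bool.eq_true_of_not_eq_false hj))
  have hring : ∀ (h : Bool) (q : Fin 4) (p : Fin 3),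
      (∀ j, z ((h, q, j - 1), p) = z ((h, q, j), p)) → ∀ j, z ((h, q, j), p) = false := by
    intro h q p hstep j
    by_contra hj
    refine hlt (le_trans (by omega) (bound_ring (S := S) (h := h) (q := q) (p := p) hz ?_))
    exact eq_true_of_step (t := fun j => z ((h, q, j), p)) hstep
      (Bool.eq_true_of_not_eq_false hj)
  have hxor : ∀ a b c : Bool, ((a ^^ b) ^^ c) = false → a = false → b = c := by decide
  have eU : ∀ h j, z ((h, 1, j), 0) = false := fun h j => (hz.1 ((h, 0, j), 0)).trans (hT h j)
  have eM : ∀ h j, z ((h, 3, j), 0) = false := fun h j => (hz.1 ((h, 2, j), 0)).trans (hD h j)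
  have sT : ∀ h j, z ((h, 0, j), 1) = z ((h, 0, j), 2) :=
    fun h j => hxor _ _ _ (hz.2 (h, 0, j)) (hT h j)
  have sU : ∀ h j, z ((h, 1, j), 1) = z ((h, 1, j), 2) :=
    fun h j => hxor _ _ _ (hz.2 (h, 1, j)) (eU h j)
  have sD : ∀ h j, z ((h, 2, j), 1) = z ((h, 2, j), 2) :=
    fun h j => hxor _ _ _ (hz.2 (h, 2, j)) (hD h j)
  have sM : ∀ h j, z ((h, 3, j), 1) = z ((h, 3, j), 2) :=
    fun h j => hxor _ _ _ (hz.2 (h, 3, j)) (eM h j)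
  have T1 : ∀ h j, z ((h, 0, j), 1) = false := fun h => hring h 0 1 fun j => by
    rw [sT h j]
    exact hz.1 ((h, 0, j), 2)
  have oU : ∀ h j, z ((h, 2, j), 2) = z ((h, 1, j), 2) := fun h j => hz.1 ((h, 1, j), 2)
  have D1 : ∀ h j, z ((h, 2, j), 1) = false := fun h => hring h 2 1 fun j => by
    rw [sD h j, oU, ← sU]
    exact hz.1 ((h, 1, j), 1)
  have M1 : ∀ h j, z ((h, 3, j), 1) = false := fun h => hring h 3 1 fun j => by
    have h1 : z ((!h, 3, 1 - j), 1) = z ((h, 3, j), 1) := hz.1 ((h, 3, j), 1)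
    have h2 : z ((!h, 3, 1 - j), 2) = z ((h, 3, j - 1), 2) := by
      have := hz.1 ((h, 3, j - 1), 2)
      rwa [baseMap_opp, opp_three_two, neg_sub] at this
    exact (sM _ _).trans (h2.symm.trans ((sM _ _).symm.trans h1))
  have hall : ∀ x, z x = false := by
    refine forall_port fun h j => ⟨⟨hT h j, T1 h j, ?_⟩, ⟨eU h j, ?_, ?_⟩,
      ⟨hD h j, D1 h j, ?_⟩, ⟨eM h j, M1 h j, ?_⟩⟩
    · rw [← sT, T1]
    · rw [sU, ← oU, ← sD, D1]
    · rw [← oU, ← sD, D1]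
    · rw [← sD, D1]
    · rw [← sM, M1]
  obtain ⟨x, hx⟩ := hne
  simp [hall] at hx

end

end Weights

end CubicMap

/-- There are infinitely many even integers `k` for which Merker's conjecture
fails: for each such `k` there is a 3-connected cubic planar graph of
circumference at least `k` whose cycle spectrum avoids `[k, 2k+2]`. -/
theorem statement8 :
    {k : ℕ | Even k ∧ ∃ (m : ℕ) (G : SimpleGraph (Fin m)),
      IsThreeConnected G ∧ IsCubic G ∧ IsPlanar G ∧ CircumferenceAtLeast G k ∧
      ∀ ℓ ∈ CycleLengths G, ¬(k ≤ ℓ ∧ ℓ ≤ 2 * k + 2)}.Infinite := by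
  refine Set.infinite_of_injective_forall_mem (f := fun t : ℕ => 2 * t + 14)
    (fun a b h => by simpa using h) fun t => ⟨⟨t + 7, by ring⟩, ?_⟩
  have : NeZero (2 * (t + 8)) := ⟨by omega⟩
  have hcard : Fintype.card (CubicMap.BaseVert (2 * (t + 8))) = 8 * (2 * (t + 8)) := by
    simp only [Fintype.card_prod, Fintype.card_bool, Fintype.card_fin, ZMod.card]
    ring
  refine CubicMap.exists_counterexample (A := CubicMap.BaseVert (2 * (t + 8)))
    (H := CubicMap.baseMap _ (by omega)) (by omega) (CubicMap.baseMap_conn (by omega)) ?_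
    (CubicMap.weight (t + 8)) _ (fun a => ?_) fun z hz hne => ?_
  · rw [CubicMap.baseMap_numFaces, hcard]
    ring
  · have := CubicMap.weight_sum_le (S := t + 8) (by omega) a
    omega
  · have := CubicMap.weight_bound (S := t + 8) (by omega) rfl hz hne
    omega
end
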